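/- arXiv:1210.0938 — 7 statements merged into one kernel-verified Lean document; each statement's English description precedes it below -/
import Mathlib

section
/- Let ε > 0 and μ ∈ ℝ with μ ≠ 0. If ψ ∈ l²(ℤ, ℂ) satisfies μ²ψ_m − ε(ψ_{m+1} + ψ_{m−1} − 2ψ_m) + |ψ_m|²ψ_m = 0 for all m ∈ ℤ, then ψ_m = 0 for all m ∈ ℤ. In other words, the stationary equation associated with the X′ and M points of the dispersion surface admits no nonzero l² solutions for any ε > 0. -/
/-- A bounded solution of the stationary equation vanishes: the supremum `S` of its modulus
satisfies `(μ² + 2ε) S ≤ 2ε S`. -/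
theorem eq_zero_of_bddAbove_of_stationary (ε μ : ℝ) (hε : 0 < ε) (hμ : μ ≠ 0)
    (ψ : ℤ → ℂ) (hψ : BddAbove (Set.range fun m => ‖ψ m‖))
    (heq : ∀ m : ℤ, (μ : ℂ) ^ 2 * ψ m
      - (ε : ℂ) * (ψ (m + 1) + ψ (m - 1) - 2 * ψ m)
      + (‖ψ m‖ : ℂ) ^ 2 * ψ m = 0) (m : ℤ) : ψ m = 0 := by
  have hμ2 : 0 < μ ^ 2 := by positivity
  have hle : ∀ n, ‖ψ n‖ ≤ ⨆ k, ‖ψ k‖ := le_ciSup hψ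
  set S := ⨆ k, ‖ψ k‖
  have hbound : ∀ n, ‖ψ n‖ ≤ 2 * ε * S / (μ ^ 2 + 2 * ε) := by
    intro n
    rw [le_div_iff₀ (by positivity)]
    have h : ((μ ^ 2 + 2 * ε + ‖ψ n‖ ^ 2 : ℝ) : ℂ) * ψ n
        = (ε : ℂ) * (ψ (n + 1) + ψ (n - 1)) := by
      push_cast
      linear_combination heq n
    have hnorm := congrArg norm h
    rw [norm_mul, norm_mul, Complex.norm_of_nonneg (by positivity),
      Complex.norm_of_nonneg hε.le] at hnorm
    have hsum : ‖ψ (n + 1) + ψ (n - 1)‖ ≤ S + S :=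
      (norm_add_le _ _).trans (add_le_add (hle _) (hle _))
    have hmul := mul_le_mul_of_nonneg_left hsum hε.le
    have hcube : 0 ≤ ‖ψ n‖ ^ 3 := by positivity
    linarith
  have hS : S ≤ 2 * ε * S / (μ ^ 2 + 2 * ε) := ciSup_le hbound
  rw [le_div_iff₀ (by positivity)] at hS
  have hS0 : S ≤ 0 := by
    by_contra! hpos
    nlinarith [mul_pos hμ2 hpos]
  exact norm_le_zero_iff.mp ((hle m).trans hS0)


/-- The stationary equation `μ²ψ_m - ε(ψ_{m+1} + ψ_{m-1} - 2ψ_m) + |ψ_m|²ψ_m = 0`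
associated with the `X'` and `M` points of the dispersion surface admits no nonzero
`l²` solutions for any `ε > 0` and `μ ≠ 0`. -/
theorem no_solitons_from_Xprime_and_M (ε μ : ℝ) (hε : 0 < ε) (hμ : μ ≠ 0)
    (ψ : ℤ → ℂ) (hψ : Memℓp ψ 2)
    (heq : ∀ m : ℤ, (μ : ℂ) ^ 2 * ψ m
      - (ε : ℂ) * (ψ (m + 1) + ψ (m - 1) - 2 * ψ m)
      + (‖ψ m‖ : ℂ) ^ 2 * ψ m = 0) :
    ∀ m : ℤ, ψ m = 0 := by
  exact eq_zero_of_bddAbove_of_stationary ε μ hε hμ ψ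
    (memℓp_infty_iff.mp (hψ.of_exponent_ge le_top)) heq
end

section
/- Let ε > 0 and μ ∈ ℝ, and let ψ ∈ l²(ℤ, ℝ) satisfy the stationary 1D dNLS equation −μ²ψ_m + ε(ψ_{m+1} + ψ_{m−1} − 2ψ_m) + ψ_m³ = 0 for all m ∈ ℤ. Then Σ_{m∈ℤ} ψ_m⁴ = μ² Σ_{m∈ℤ} ψ_m² + ε Σ_{m∈ℤ} (ψ_{m+1} − ψ_m)², and consequently ‖ψ‖⁴_{l⁴} ≥ μ² ‖ψ‖²_{l²}. -/
/-- If `ψ ∈ l²(ℤ,ℝ)` solves the stationary 1D dNLS equation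
`-μ²ψ_m + ε(ψ_{m+1} + ψ_{m-1} - 2ψ_m) + ψ_m³ = 0` with `ε > 0`, then
`Σ ψ_m⁴ = μ² Σ ψ_m² + ε Σ (ψ_{m+1} - ψ_m)²`, and consequently
`‖ψ‖⁴_{l⁴} ≥ μ² ‖ψ‖²_{l²}`. -/
theorem stationary_soliton_l4_identity (ε μ : ℝ) (hε : 0 < ε)
    (ψ : ℤ → ℝ) (hψ : Memℓp ψ 2)
    (heq : ∀ m : ℤ, -μ ^ 2 * ψ m + ε * (ψ (m + 1) + ψ (m - 1) - 2 * ψ m) + (ψ m) ^ 3 = 0) :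
    (∑' m : ℤ, (ψ m) ^ 4)
      = μ ^ 2 * (∑' m : ℤ, (ψ m) ^ 2) + ε * (∑' m : ℤ, (ψ (m + 1) - ψ m) ^ 2) ∧
    μ ^ 2 * (∑' m : ℤ, (ψ m) ^ 2) ≤ ∑' m : ℤ, (ψ m) ^ 4 := by
  have hs : Summable fun m : ℤ => (ψ m) ^ 2 := by
    have h := hψ.summable (by norm_num)
    simpa using h
  have hs1 : HasSum (fun m : ℤ => (ψ (m + 1)) ^ 2) (∑' m : ℤ, (ψ m) ^ 2) :=
    (Equiv.addRight (1 : ℤ)).hasSum_iff.mpr hs.hasSum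
  have hp : Summable fun m : ℤ => ψ m * ψ (m + 1) := by
    refine Summable.of_norm_bounded (hs.add hs1.summable) fun m => ?_
    rw [Real.norm_eq_abs, abs_le]
    constructor <;>
      nlinarith [sq_nonneg (ψ m + ψ (m + 1)), sq_nonneg (ψ m - ψ (m + 1)),
        sq_nonneg (ψ m), sq_nonneg (ψ (m + 1))]
  have hp1 : HasSum (fun m : ℤ => ψ (m - 1) * ψ m) (∑' m : ℤ, ψ m * ψ (m + 1)) := by
    simpa [Function.comp_def] using (Equiv.subRight (1 : ℤ)).hasSum_iff.mpr hp.hasSum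
  have hdiff : HasSum (fun m : ℤ => (ψ (m + 1) - ψ m) ^ 2)
      ((∑' m : ℤ, (ψ m) ^ 2) + (∑' m : ℤ, (ψ m) ^ 2) - 2 * ∑' m : ℤ, ψ m * ψ (m + 1)) := by
    refine ((hs1.add hs.hasSum).sub (hp.hasSum.mul_left 2)).congr_fun fun m => ?_
    ring
  have hfour : HasSum (fun m : ℤ => (ψ m) ^ 4)
      (μ ^ 2 * (∑' m : ℤ, (ψ m) ^ 2) - ε * ((∑' m : ℤ, ψ m * ψ (m + 1))
        + (∑' m : ℤ, ψ m * ψ (m + 1)) - 2 * ∑' m : ℤ, (ψ m) ^ 2)) := by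
    refine ((hs.hasSum.mul_left (μ ^ 2)).sub
      (((hp.hasSum.add hp1).sub (hs.hasSum.mul_left 2)).mul_left ε)).congr_fun fun m => ?_
    linear_combination ψ m * heq m
  have key : (∑' m : ℤ, (ψ m) ^ 4)
      = μ ^ 2 * (∑' m : ℤ, (ψ m) ^ 2) + ε * (∑' m : ℤ, (ψ (m + 1) - ψ m) ^ 2) := by
    rw [hfour.tsum_eq, hdiff.tsum_eq]
    ring
  refine ⟨key, ?_⟩
  rw [key]
  exact le_add_of_nonneg_right (mul_nonneg hε.le (tsum_nonneg fun m => sq_nonneg _))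
end

section
/- Let ε > 0, μ = 1, let ψ ∈ l²(ℤ, ℝ) be a nonzero solution of the stationary 1D dNLS equation −ψ_m + ε(ψ_{m+1} + ψ_{m−1} − 2ψ_m) + ψ_m³ = 0 for all m ∈ ℤ, and for p ∈ ℝ let L₊(p) be the Γ-point linearization operator on l²(ℤ, ℝ) given by (L₊(p)U)_m = −ε[U_{m+1} + U_{m−1} + 2cos(p)U_m − 4U_m] + U_m − 3ψ_m²U_m. Then ⟨L₊(p)ψ, ψ⟩ ≤ 2(ε(1 − cos p) − 1)‖ψ‖²_{l²}; in particular, whenever ε(1 − cos p) < 1 (for example for all p ∈ [−π,π] if 0 < ε < 1/2), one has ⟨L₊(p)ψ, ψ⟩ < 0, so L₊(p) has at least one negative eigenvalue. -/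
section DiscreteSchrodinger

theorem memlp_two_iff_summable_sq (U : ℤ → ℝ) :
    Memℓp U 2 ↔ Summable fun m => U m ^ 2 := by
  rw [memℓp_gen_iff (by norm_num)]
  simp

theorem Summable.sq_shift {U : ℤ → ℝ} (hU : Summable fun m => U m ^ 2) (k : ℤ) :
    Summable fun m => U (m + k) ^ 2 :=
  (Equiv.addRight k).summable_iff.mpr hU

theorem Summable.mul_of_sq {U V : ℤ → ℝ} (hU : Summable fun m => U m ^ 2)
    (hV : Summable fun m => V m ^ 2) : Summable fun m => U m * V m := by
  refine Summable.of_norm_bounded (hU.add hV) fun m => ?_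
  rw [Real.norm_eq_abs, abs_le]
  constructor <;> nlinarith [sq_nonneg (U m + V m), sq_nonneg (U m - V m)]

theorem Summable.sq_sub {U V : ℤ → ℝ} (hU : Summable fun m => U m ^ 2)
    (hV : Summable fun m => V m ^ 2) : Summable fun m => (U m - V m) ^ 2 := by
  refine ((hU.add hV).sub ((hU.mul_of_sq hV).mul_left 2)).congr fun m => ?_
  ring

/-- Summation by parts for the discrete Laplacian on `ℓ²(ℤ)`. -/
theorem hasSum_discreteLaplacian_mul {U : ℤ → ℝ} (hU : Summable fun m => U m ^ 2) :
    HasSum (fun m => (U (m + 1) + U (m - 1) - 2 * U m) * U m)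
      (-∑' m, (U (m + 1) - U m) ^ 2) := by
  have hs : Summable fun m => U m ^ 2 - U m * U (m - 1) := by
    simpa only [sub_eq_add_neg] using hU.sub (hU.mul_of_sq (hU.sq_shift (-1)))
  have hs_shift : HasSum (fun m => U (m + 1) ^ 2 - U (m + 1) * U m)
      (∑' m, (U m ^ 2 - U m * U (m - 1))) := by
    simpa [Function.comp_def] using (Equiv.addRight (1 : ℤ)).hasSum_iff.mpr hs.hasSum
  have h := (hs_shift.sub hs.hasSum).sub ((hU.sq_shift 1).sq_sub hU).hasSum
  rw [sub_self, zero_sub] at h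
  refine h.congr_fun fun m => ?_
  ring

/-- Density of the quadratic form of the discrete Schrödinger operator `-εΔ + w`. -/
def schrodingerDensity (ε : ℝ) (w U : ℤ → ℝ) (m : ℤ) : ℝ :=
  ε * (U (m + 1) - U m) ^ 2 + w m * U m ^ 2

theorem summable_schrodingerDensity (ε : ℝ) {w U : ℤ → ℝ} {C : ℝ} (hw : ∀ m, |w m| ≤ C)
    (hU : Summable fun m => U m ^ 2) : Summable (schrodingerDensity ε w U) := by
  refine (((hU.sq_shift 1).sq_sub hU).mul_left ε).add
    (Summable.of_norm_bounded (hU.mul_left C) fun m => ?_)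
  rw [norm_mul, Real.norm_eq_abs, Real.norm_eq_abs, abs_of_nonneg (sq_nonneg (U m))]
  gcongr
  exact hw m

/-- A minimizer of a nonnegative quadratic form of `-εΔ + w` lies in its kernel. -/
theorem schrodinger_eq_zero_of_tsum_nonpos {ε : ℝ} {w : ℤ → ℝ} {C : ℝ}
    (hw : ∀ m, |w m| ≤ C)
    (hnonneg : ∀ V : ℤ → ℝ, (Summable fun m => V m ^ 2) →
      0 ≤ ∑' m, schrodingerDensity ε w V m)
    {U : ℤ → ℝ} (hU : Summable fun m => U m ^ 2)
    (hle : ∑' m, schrodingerDensity ε w U m ≤ 0) (k : ℤ) :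
    -ε * (U (k + 1) + U (k - 1) - 2 * U k) + w k * U k = 0 := by
  have key : ∀ t : ℝ,
      0 ≤ 2 * t * (-ε * (U (k + 1) + U (k - 1) - 2 * U k) + w k * U k)
        + t ^ 2 * (2 * ε + w k) := by
    intro t
    set V : ℤ → ℝ := fun m => U m + Pi.single (M := fun _ => ℝ) k t m with hV
    have hδ : Summable fun m => (Pi.single (M := fun _ => ℝ) k t m) ^ 2 :=
      summable_of_ne_finset_zero (s := {k}) fun m hm => by
        simp [Pi.single_eq_of_ne (Finset.notMem_singleton.mp hm)]
    have hVs : Summable fun m => V m ^ 2 := by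
      refine ((hU.add hδ).add ((hU.mul_of_sq hδ).mul_left 2)).congr fun m => ?_
      simp only [hV]; ring
    have hsum := ((summable_schrodingerDensity ε hw hU).hasSum.add
      (hasSum_pi_single (k - 1) (ε * ((U k + t - U (k - 1)) ^ 2 - (U k - U (k - 1)) ^ 2)))).add
      (hasSum_pi_single k (ε * ((U (k + 1) - (U k + t)) ^ 2 - (U (k + 1) - U k) ^ 2)
        + w k * ((U k + t) ^ 2 - U k ^ 2)))
    have hV_eq : ∀ m, schrodingerDensity ε w V m = schrodingerDensity ε w U m
        + Pi.single (M := fun _ => ℝ) (k - 1)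
          (ε * ((U k + t - U (k - 1)) ^ 2 - (U k - U (k - 1)) ^ 2)) m
        + Pi.single (M := fun _ => ℝ) k
          (ε * ((U (k + 1) - (U k + t)) ^ 2 - (U (k + 1) - U k) ^ 2)
            + w k * ((U k + t) ^ 2 - U k ^ 2)) m := by
      intro m
      rcases eq_or_ne m k with rfl | h1
      · simp [schrodingerDensity, hV, Pi.single_apply]
        ring
      · rcases eq_or_ne m (k - 1) with rfl | h2
        · simp [schrodingerDensity, hV, Pi.single_apply]
          ring
        · have h3 : m + 1 ≠ k := fun h => h2 (by omega)
          simp [schrodingerDensity, hV, Pi.single_apply, h1, h2, h3]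
    have := hnonneg V hVs
    rw [(hsum.congr_fun hV_eq).tsum_eq] at this
    nlinarith
  set A := -ε * (U (k + 1) + U (k - 1) - 2 * U k) + w k * U k
  set B := 2 * ε + w k
  have hlin := discrim_le_zero (a := B) (b := 2 * A) (c := 0) fun t => by
    nlinarith [key t]
  rw [discrim] at hlin
  nlinarith [sq_nonneg A]

theorem exists_minimizer_schrodinger {ε c : ℝ} (hε : 0 ≤ ε) (hc : 0 ≤ c) {v : ℤ → ℝ}
    (hv0 : ∀ m, 0 ≤ v m) (hv : Summable v) :
    ∃ U : ℤ → ℝ, (Summable fun m => U m ^ 2) ∧ ∑' m, U m ^ 2 ≤ 1 ∧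
      ∀ V : ℤ → ℝ, (Summable fun m => V m ^ 2) → ∑' m, V m ^ 2 ≤ 1 →
        ∑' m, schrodingerDensity ε (fun m => c - v m) U m ≤
          ∑' m, schrodingerDensity ε (fun m => c - v m) V m := by
  set K : Set (ℤ → ℝ) := {U | ∑' m, ENNReal.ofReal (U m ^ 2) ≤ 1} with hK
  set g : (ℤ → ℝ) → ℤ → ℝ := fun U m =>
    schrodingerDensity ε (fun m => c - v m) U m + v m with hg
  have hmem : ∀ U, U ∈ K ↔ (Summable fun m => U m ^ 2) ∧ ∑' m, U m ^ 2 ≤ 1 := by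
    intro U
    constructor
    · intro h
      have hs : Summable fun m => U m ^ 2 := by
        have := ENNReal.summable_toReal (ne_top_of_le_ne_top ENNReal.one_ne_top h)
        simpa [ENNReal.toReal_ofReal, sq_nonneg] using this
      refine ⟨hs, ?_⟩
      rwa [hK, Set.mem_ofPred_eq, ← ENNReal.ofReal_tsum_of_nonneg (fun m => sq_nonneg _) hs,
        ENNReal.ofReal_le_one] at h
    · rintro ⟨hs, h⟩
      rwa [hK, Set.mem_ofPred_eq, ← ENNReal.ofReal_tsum_of_nonneg (fun m => sq_nonneg _) hs,
        ENNReal.ofReal_le_one]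
  have hle : ∀ U ∈ K, ∀ m, U m ^ 2 ≤ 1 := fun U h m =>
    (((hmem U).mp h).1.le_tsum m fun _ _ => sq_nonneg _).trans ((hmem U).mp h).2
  have hclosed : IsClosed K :=
    (lowerSemicontinuous_tsum fun m =>
      (ENNReal.continuous_ofReal.comp
        (by fun_prop : Continuous fun U : ℤ → ℝ => U m ^ 2)).lowerSemicontinuous).isClosed_preimage 1
  have hcompact : IsCompact K := by
    refine (isCompact_univ_pi fun _ : ℤ =>
      isCompact_Icc (a := (-1 : ℝ)) (b := 1)).of_isClosed_subset hclosed fun U h m _ => ?_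
    exact abs_le.mp (sq_le_one_iff_abs_le_one _ |>.mp (hle U h m))
  have hlsc : LowerSemicontinuous fun U : ℤ → ℝ => ∑' m, ENNReal.ofReal (g U m) :=
    lowerSemicontinuous_tsum fun m => by
      refine (ENNReal.continuous_ofReal.comp ?_).lowerSemicontinuous
      simp only [hg, schrodingerDensity]
      fun_prop
  obtain ⟨U, hUK, hmin⟩ := (hlsc.lowerSemicontinuousOn K).exists_isMinOn
    ⟨0, by simp [hK]⟩ hcompact
  have hgnn : ∀ V ∈ K, ∀ m, 0 ≤ g V m := fun V h m => by
    have h1 := mul_nonneg hε (sq_nonneg (V (m + 1) - V m))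
    have h2 := mul_nonneg hc (sq_nonneg (V m))
    have h3 := mul_nonneg (hv0 m) (sub_nonneg.mpr (hle V h m))
    simp only [hg, schrodingerDensity]
    nlinarith
  have hbound : ∀ m, |c - v m| ≤ c + ∑' m, v m := fun m => by
    have := hv.le_tsum m fun j _ => hv0 j
    have := hv0 m
    rw [abs_le]; constructor <;> linarith
  have hsumm : ∀ V ∈ K, Summable (schrodingerDensity ε (fun m => c - v m) V) := fun V h =>
    summable_schrodingerDensity ε hbound ((hmem V).mp h).1
  refine ⟨U, ((hmem U).mp hUK).1, ((hmem U).mp hUK).2, fun V hV hV1 => ?_⟩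
  have hVK : V ∈ K := (hmem V).mpr ⟨hV, hV1⟩
  have h : ∑' m, ENNReal.ofReal (g U m) ≤ ∑' m, ENNReal.ofReal (g V m) := hmin hVK
  rw [← ENNReal.ofReal_tsum_of_nonneg (hgnn U hUK) ((hsumm U hUK).add hv),
    ← ENNReal.ofReal_tsum_of_nonneg (hgnn V hVK) ((hsumm V hVK).add hv),
    ENNReal.ofReal_le_ofReal_iff (tsum_nonneg (hgnn V hVK)),
    (hsumm U hUK).tsum_add hv, (hsumm V hVK).tsum_add hv] at h
  linarith

theorem tsum_schrodingerDensity_smul (ε : ℝ) (w U : ℤ → ℝ) (a : ℝ) :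
    ∑' m, schrodingerDensity ε w (fun m => a * U m) m
      = a ^ 2 * ∑' m, schrodingerDensity ε w U m := by
  rw [← tsum_mul_left]
  refine tsum_congr fun m => ?_
  simp only [schrodingerDensity]; ring

/-- If the quadratic form of `-εΔ + c - v`, with `c ≥ 0` and `v ≥ 0` summable, takes a negative
value, then the operator has a negative eigenvalue. -/
theorem exists_neg_eigenvalue_schrodinger {ε c : ℝ} (hε : 0 ≤ ε) (hc : 0 ≤ c) {v : ℤ → ℝ}
    (hv0 : ∀ m, 0 ≤ v m) (hv : Summable v) {φ : ℤ → ℝ} (hφ : Summable fun m => φ m ^ 2)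
    (hneg : ∑' m, schrodingerDensity ε (fun m => c - v m) φ m < 0) :
    ∃ β < 0, ∃ U : ℤ → ℝ, (Summable fun m => U m ^ 2) ∧ U ≠ 0 ∧
      ∀ m, -ε * (U (m + 1) + U (m - 1) - 2 * U m) + (c - v m) * U m = β * U m := by
  obtain ⟨U, hU, hU1, hmin⟩ := exists_minimizer_schrodinger hε hc hv0 hv
  set w : ℤ → ℝ := fun m => c - v m with hw
  set β := ∑' m, schrodingerDensity ε w U m with hβ
  have hform : ∀ V : ℤ → ℝ, (Summable fun m => V m ^ 2) →
      β * ∑' m, V m ^ 2 ≤ ∑' m, schrodingerDensity ε w V m := by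
    intro V hV
    rcases (tsum_nonneg fun m => sq_nonneg (V m)).eq_or_lt with h0 | hpos
    · have hz : V = 0 := by
        funext m
        have := hV.le_tsum m fun _ _ => sq_nonneg _
        rw [← h0] at this
        exact pow_eq_zero_iff two_ne_zero |>.mp (le_antisymm this (sq_nonneg _))
      simp [hz, schrodingerDensity]
    · set N := ∑' m, V m ^ 2
      have ha : (√N)⁻¹ ^ 2 = N⁻¹ := by rw [inv_pow, Real.sq_sqrt hpos.le]
      have h := hmin (fun m => (√N)⁻¹ * V m)
        (by simpa only [mul_pow] using hV.mul_left _)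
        (by simp only [mul_pow, tsum_mul_left, ha]; exact (inv_mul_cancel₀ hpos.ne').le)
      rw [tsum_schrodingerDensity_smul, ha, inv_mul_eq_div, le_div_iff₀ hpos] at h
      exact h
  have hβneg : β < 0 := by
    by_contra! h
    exact absurd (hform φ hφ) (not_le.mpr (hneg.trans_le
      (mul_nonneg h (tsum_nonneg fun m => sq_nonneg _))))
  have hbound : ∀ b m, |w m - b| ≤ |c| + |b| + ∑' m, v m := fun b m => by
    have h1 := hv.le_tsum m fun j _ => hv0 j
    have h2 := hv0 m
    have := le_abs_self c
    have := neg_abs_le c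
    have := le_abs_self b
    have := neg_abs_le b
    rw [hw, abs_le]; constructor <;> linarith
  have hshift : ∀ V : ℤ → ℝ, (Summable fun m => V m ^ 2) →
      ∑' m, schrodingerDensity ε (fun m => w m - β) V m
        = ∑' m, schrodingerDensity ε w V m - β * ∑' m, V m ^ 2 := by
    intro V hV
    have hs : Summable (schrodingerDensity ε w V) :=
      summable_schrodingerDensity ε (by simpa using hbound 0) hV
    rw [← tsum_mul_left, ← hs.tsum_sub (hV.mul_left β)]
    refine tsum_congr fun m => ?_
    simp only [schrodingerDensity]; ring
  refine ⟨β, hβneg, U, hU, ?_, fun m => ?_⟩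
  · intro h
    simp [hβ, h, schrodingerDensity] at hβneg
  · have := schrodinger_eq_zero_of_tsum_nonpos (hbound β)
      (fun V hV => by rw [hshift V hV]; linarith [hform V hV]) hU
      (by rw [hshift U hU]; nlinarith) m
    linarith

end DiscreteSchrodinger

/-- For a nonzero solution `ψ ∈ l²(ℤ,ℝ)` of the stationary 1D dNLS equation with
`μ = 1`, the quadratic form of the Γ-point linearization operator `L₊(p)` at `ψ`
satisfies `⟨L₊(p)ψ, ψ⟩ ≤ 2(ε(1 - cos p) - 1)‖ψ‖²`; in particular, whenever
`ε(1 - cos p) < 1`, one has `⟨L₊(p)ψ, ψ⟩ < 0`, so `L₊(p)` has at least one negative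
eigenvalue. -/
theorem Lplus_Gamma_quadratic_form_bound (ε p : ℝ) (hε : 0 < ε)
    (ψ : ℤ → ℝ) (hψ : Memℓp ψ 2) (hψ0 : ψ ≠ 0)
    (heq : ∀ m : ℤ, -ψ m + ε * (ψ (m + 1) + ψ (m - 1) - 2 * ψ m) + (ψ m) ^ 3 = 0)
    (L : (ℤ → ℝ) → ℤ → ℝ)
    (hL : L = fun U m => -ε * (U (m + 1) + U (m - 1) + 2 * Real.cos p * U m - 4 * U m)
      + U m - 3 * (ψ m) ^ 2 * U m) :
    (∑' m : ℤ, L ψ m * ψ m) ≤ 2 * (ε * (1 - Real.cos p) - 1) * ∑' m : ℤ, (ψ m) ^ 2 ∧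
    (ε * (1 - Real.cos p) < 1 →
      (∑' m : ℤ, L ψ m * ψ m) < 0 ∧
      ∃ β : ℝ, β < 0 ∧ ∃ U : ℤ → ℝ, Memℓp U 2 ∧ U ≠ 0 ∧ ∀ m : ℤ, L U m = β * U m) := by
  have hs : Summable fun m => ψ m ^ 2 := (memlp_two_iff_summable_sq ψ).mp hψ
  have hpos : 0 < ∑' m, ψ m ^ 2 := by
    obtain ⟨k, hk⟩ := Function.ne_iff.mp hψ0
    exact hs.tsum_pos (fun m => sq_nonneg _) k (by have : ψ k ≠ 0 := hk; positivity)
  have hlap := hasSum_discreteLaplacian_mul hs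
  set D := ∑' m, (ψ (m + 1) - ψ m) ^ 2 with hD
  have hD0 : 0 ≤ D := tsum_nonneg fun m => sq_nonneg _
  have hLψ : HasSum (fun m => L ψ m * ψ m)
      (2 * (ε * (1 - Real.cos p) - 1) * ∑' m, ψ m ^ 2 + 2 * ε * -D) := by
    refine ((hs.hasSum.mul_left _).add (hlap.mul_left (2 * ε))).congr_fun fun m => ?_
    simp only [hL]
    linear_combination (-3 * ψ m) * heq m
  have hbound : ∑' m, L ψ m * ψ m ≤ 2 * (ε * (1 - Real.cos p) - 1) * ∑' m, ψ m ^ 2 := by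
    rw [hLψ.tsum_eq]
    nlinarith
  refine ⟨hbound, fun hp => ?_⟩
  have hneg : ∑' m, L ψ m * ψ m < 0 :=
    hbound.trans_lt (mul_neg_of_neg_of_pos (by linarith) hpos)
  refine ⟨hneg, ?_⟩
  have hc : 0 ≤ 1 + 2 * ε * (1 - Real.cos p) := by
    nlinarith [Real.cos_le_one p]
  have hform : ∑' m, schrodingerDensity ε
      (fun m => 1 + 2 * ε * (1 - Real.cos p) - 3 * ψ m ^ 2) ψ m = ∑' m, L ψ m * ψ m := by
    have h := (hLψ.add (hlap.mul_left ε)).add (((hs.sq_shift 1).sq_sub hs).hasSum.mul_left ε)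
    rw [hLψ.tsum_eq]
    refine (h.congr_fun fun m => ?_).tsum_eq.trans (by ring)
    simp only [schrodingerDensity, hL]
    ring
  obtain ⟨β, hβ, U, hU, hU0, hUβ⟩ := exists_neg_eigenvalue_schrodinger hε.le hc
    (v := fun m => 3 * ψ m ^ 2) (fun m => by positivity) (hs.mul_left 3) hs (hform ▸ hneg)
  refine ⟨β, hβ, U, (memlp_two_iff_summable_sq U).mpr hU, hU0, fun m => ?_⟩
  rw [← hUβ m]
  simp only [hL]
  ring
end

section
/- (Theorem 1, instability at the Γ point.) Let μ = 1 and ε > 0, and let ψ ∈ l²(ℤ, ℝ) with ψ_m > 0 for all m ∈ ℤ be a solution of the stationary 1D dNLS equation −ψ_m + ε(ψ_{m+1} + ψ_{m−1} − 2ψ_m) + ψ_m³ = 0, such that the self-adjoint operator L₊(0) on l²(ℤ, ℝ) has exactly one negative eigenvalue (counted with multiplicity) and trivial kernel. Then there exists p₀ ∈ (0, π] such that for every p with 0 < |p| < p₀ there exist λ > 0 and a nonzero pair (U, W) ∈ l²(ℤ, ℝ)² with L₊(p)U = −λW and L₋(p)W = λU; hence ±λ is a symmetric pair of real eigenvalues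 of the linear-stability problem, and the fundamental discrete line soliton bifurcating from the Γ point is transversely unstable. Moreover, if 0 < ε < 1/2 one may take p₀ = π. -/
namespace LatticeL2

open scoped RealInnerProductSpace
open Module.End

section Abstract

variable {H : Type*} [NormedAddCommGroup H] [InnerProductSpace ℝ H]

/-- A symmetric bounded operator with nonnegative form satisfies `‖T x‖² ≤ ‖T‖ ⟪T x, x⟫`. -/
theorem norm_apply_sq_le_of_nonneg {T : H →L[ℝ] H}
    (hsymm : ∀ x y, ⟪T x, y⟫ = ⟪x, T y⟫) (hpos : ∀ x, 0 ≤ ⟪T x, x⟫) (x : H) :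
    ‖T x‖ ^ 2 ≤ ‖T‖ * ⟪T x, x⟫ := by
  have key : ∀ t : ℝ, 0 ≤ ⟪T (T x), T x⟫ * (t * t) + 2 * ‖T x‖ ^ 2 * t + ⟪T x, x⟫ := by
    intro t
    have h := hpos (x + t • T x)
    simp only [map_add, map_smul, inner_add_left, inner_add_right, inner_smul_left,
      inner_smul_right, hsymm (T x) x, RCLike.conj_to_real, real_inner_self_eq_norm_sq] at h
    linarith
  have hd := discrim_le_zero key
  have hT : ⟪T (T x), T x⟫ ≤ ‖T‖ * ‖T x‖ ^ 2 := by
    calc ⟪T (T x), T x⟫ ≤ ‖T (T x)‖ * ‖T x‖ := real_inner_le_norm _ _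
      _ ≤ ‖T‖ * ‖T x‖ * ‖T x‖ := by gcongr; exact T.le_opNorm _
      _ = _ := by ring
  rcases eq_or_ne (T x) 0 with h0 | h0
  · simp [h0]
  have hn : 0 < ‖T x‖ ^ 2 := by positivity
  rw [discrim] at hd
  have hm := mul_le_mul_of_nonneg_right hT (hpos x)
  refine le_of_mul_le_mul_left ?_ hn
  nlinarith

/-- The symmetric operator `B - K`, with `B` coercive and `K` compact, is either not injective or,
when its form is nonnegative, coercive. -/
theorem exists_ne_zero_apply_eq_zero_or_coercive [CompleteSpace H] {B K : H →L[ℝ] H}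
    (hB : ∃ c, 0 < c ∧ ∀ x, c * ‖x‖ ^ 2 ≤ ⟪B x, x⟫) (hK : IsCompactOperator K)
    (hsymm : ∀ x y, ⟪(B - K) x, y⟫ = ⟪x, (B - K) y⟫) (hpos : ∀ x, 0 ≤ ⟪(B - K) x, x⟫) :
    (∃ x, x ≠ 0 ∧ (B - K) x = 0) ∨ ∃ c, 0 < c ∧ ∀ x, c * ‖x‖ ^ 2 ≤ ⟪(B - K) x, x⟫ := by
  obtain ⟨c, hc, hBc⟩ := hB
  have hunit : IsUnit B := by
    refine ContinuousLinearMap.isUnit_of_forall_le_norm_inner_map B (c := ⟨c, hc.le⟩) hc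
      fun x => ?_
    rw [Real.norm_eq_abs, mul_comm]
    exact (hBc x).trans (le_abs_self _)
  obtain ⟨u, rfl⟩ := hunit
  set V : H →L[ℝ] H := ((u⁻¹ : (H →L[ℝ] H)ˣ) : H →L[ℝ] H) with hV
  have huV : ∀ x, (u : H →L[ℝ] H) (V x) = x := fun x => by
    rw [hV, ← mul_apply_eq_comp, u.mul_inv, one_apply_eq_self]
  have hVu : ∀ x, V ((u : H →L[ℝ] H) x) = x := fun x => by
    rw [hV, ← mul_apply_eq_comp, u.inv_mul, one_apply_eq_self]
  set C : H →L[ℝ] H := V.comp K with hC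
  have hCc : IsCompactOperator C := hK.clm_comp V
  by_cases hev : HasEigenvalue (C : Module.End ℝ H) 1
  · obtain ⟨x, hx⟩ := hev.exists_hasEigenvector
    refine Or.inl ⟨x, hx.2, ?_⟩
    have h1 : V (K x) = x := by simpa [hC] using hx.apply_eq_smul
    have h2 := congrArg (u : H →L[ℝ] H) h1
    rw [huV] at h2
    simp [h2]
  · right
    obtain ⟨k, hk⟩ := hCc.antilipschitz_of_not_hasEigenvalue one_ne_zero hev
    set T : H →L[ℝ] H := (u : H →L[ℝ] H) - K with hT
    have hbound : ∀ x, ‖x‖ ≤ k * ‖V‖ * ‖T x‖ := fun x => by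
      have hx : (C - (1 : ℝ) • (1 : H →L[ℝ] H)) x = -V (T x) := by
        simp [hT, hC, hVu]
      have h1 := hk.le_mul_dist x 0
      rw [map_zero, dist_zero_right, dist_zero_right, hx, norm_neg] at h1
      calc ‖x‖ ≤ k * ‖V (T x)‖ := h1
        _ ≤ k * (‖V‖ * ‖T x‖) := by gcongr; exact V.le_opNorm _
        _ = _ := by ring
    set M : ℝ := (k * ‖V‖) ^ 2 * ‖T‖ + 1 with hM
    have hM0 : 0 < M := by positivity
    refine ⟨M⁻¹, inv_pos.2 hM0, fun x => ?_⟩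
    rw [inv_mul_le_iff₀ hM0]
    calc ‖x‖ ^ 2 ≤ (k * ‖V‖ * ‖T x‖) ^ 2 := by gcongr; exact hbound x
      _ = (k * ‖V‖) ^ 2 * ‖T x‖ ^ 2 := by ring
      _ ≤ (k * ‖V‖) ^ 2 * (‖T‖ * ⟪T x, x⟫) := by
        gcongr; exact norm_apply_sq_le_of_nonneg hsymm hpos x
      _ ≤ M * ⟪T x, x⟫ := by rw [hM]; linarith [hpos x]

/-- If `P` is symmetric and coercive and `A - K` is symmetric with `A` nonnegative and `K` compact,
then a negative direction of `A - K` in the range of `P` produces a real eigenvalue `l > 0` of the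
Hamiltonian system `(A - K) U = -l W`, `P W = l U`. -/
theorem exists_hamiltonian_eigenvalue [CompleteSpace H] {A K P : H →L[ℝ] H}
    (hA : ∀ x, 0 ≤ ⟪A x, x⟫) (hK : IsCompactOperator K)
    (hAK : ∀ x y, ⟪(A - K) x, y⟫ = ⟪x, (A - K) y⟫) (hP : ∀ x y, ⟪P x, y⟫ = ⟪x, P y⟫)
    (hPc : ∃ c, 0 < c ∧ ∀ x, c * ‖x‖ ^ 2 ≤ ⟪P x, x⟫)
    (hneg : ∃ x, ⟪(A - K) (P x), P x⟫ < 0) :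
    ∃ l : ℝ, 0 < l ∧ ∃ U W : H, W ≠ 0 ∧ (A - K) U = -l • W ∧ P W = l • U := by
  obtain ⟨c, hc, hPc⟩ := hPc
  obtain ⟨v, hv⟩ := hneg
  set L : H →L[ℝ] H := A - K with hL
  have hP0 : ∀ x, 0 ≤ ⟪P x, x⟫ := fun x => le_trans (by positivity) (hPc x)
  set S : Set ℝ := {t | ∀ x, 0 ≤ ⟪L (P x), P x⟫ + t * ⟪P x, x⟫} with hS
  have hSpos : ∀ t ∈ S, 0 < t := fun t ht => by
    by_contra! h
    nlinarith [ht v, hP0 v]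
  have hSbdd : BddBelow S := ⟨0, fun t ht => (hSpos t ht).le⟩
  have hSne : S.Nonempty := by
    refine ⟨‖L‖ * ‖P‖ ^ 2 / c, fun x => ?_⟩
    have h1 : |⟪L (P x), P x⟫| ≤ ‖L‖ * ‖P‖ ^ 2 * ‖x‖ ^ 2 :=
      calc |⟪L (P x), P x⟫| ≤ ‖L (P x)‖ * ‖P x‖ := abs_real_inner_le_norm _ _
        _ ≤ ‖L‖ * ‖P x‖ * ‖P x‖ := by gcongr; exact L.le_opNorm _
        _ ≤ ‖L‖ * (‖P‖ * ‖x‖) * (‖P‖ * ‖x‖) := by gcongr <;> exact P.le_opNorm _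
        _ = _ := by ring
    have h2 : ‖L‖ * ‖P‖ ^ 2 * ‖x‖ ^ 2 ≤ ‖L‖ * ‖P‖ ^ 2 / c * ⟪P x, x⟫ := by
      calc ‖L‖ * ‖P‖ ^ 2 * ‖x‖ ^ 2 = ‖L‖ * ‖P‖ ^ 2 / c * (c * ‖x‖ ^ 2) := by field_simp
        _ ≤ _ := by gcongr; exact hPc x
    linarith [neg_abs_le ⟪L (P x), P x⟫]
  have hSclosed : IsClosed S := by
    rw [hS, Set.ofPred_forall]
    exact isClosed_iInter fun x => isClosed_le continuous_const (by fun_prop)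
  set t : ℝ := sInf S with ht
  have htS : t ∈ S := hSclosed.csInf_mem hSne hSbdd
  have ht0 : 0 < t := hSpos t htS
  have hTx : ∀ x, (P.comp (A.comp P) + t • P - P.comp (K.comp P)) x = P (L (P x) + t • x) :=
    fun x => by
      simp only [hL, sub_apply, add_apply,
        ContinuousLinearMap.comp_apply, smul_apply, map_add, map_sub,
        map_smul]
      abel
  have hform : ∀ x y, ⟪P (L (P x) + t • x), y⟫ = ⟪L (P x), P y⟫ + t * ⟪P x, y⟫ := fun x y => by
    rw [map_add, inner_add_left, map_smul, real_inner_smul_left, hP]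
  have hdich := exists_ne_zero_apply_eq_zero_or_coercive
    (B := P.comp (A.comp P) + t • P) (K := P.comp (K.comp P))
    ⟨t * c, by positivity, fun x => ?_⟩ ((hK.comp_clm P).clm_comp P) (fun x y => ?_) (fun x => ?_)
  rotate_left
  · have h1 : ⟪P (A (P x)), x⟫ = ⟪A (P x), P x⟫ := hP _ _
    simp only [add_apply, ContinuousLinearMap.comp_apply,
      smul_apply, inner_add_left, real_inner_smul_left, h1]
    nlinarith [hA (P x), mul_le_mul_of_nonneg_left (hPc x) ht0.le]
  · rw [hTx, hTx, hform, real_inner_comm _ x, hform, hAK, real_inner_comm, hP,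
      real_inner_comm (P y)]
  · rw [hTx, hform]
    exact htS x
  rcases hdich with ⟨x, hx0, hx⟩ | ⟨d, hd, hcoer⟩
  · rw [hTx] at hx
    have hz : L (P x) + t • x = 0 := by
      have h := hPc (L (P x) + t • x)
      rw [hx, inner_zero_left] at h
      have h2 : ‖L (P x) + t • x‖ ^ 2 ≤ 0 := by
        by_contra! h3
        nlinarith [mul_pos hc h3]
      simpa using le_antisymm h2 (by positivity)
    have hs : 0 < √t := Real.sqrt_pos.2 ht0
    refine ⟨√t, hs, (√t)⁻¹ • P x, x, hx0, ?_, ?_⟩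
    · rw [map_smul, eq_neg_of_add_eq_zero_left hz, smul_neg, smul_smul, neg_smul]
      congr 2
      rw [inv_mul_eq_div, Real.div_sqrt]
    · rw [smul_smul, mul_inv_cancel₀ hs.ne', one_smul]
  · exfalso
    have hmem : t - d / (‖P‖ + 1) ∈ S := fun x => by
      have h1 := hcoer x
      rw [hTx, hform] at h1
      have h2 : ⟪P x, x⟫ ≤ (‖P‖ + 1) * ‖x‖ ^ 2 := by
        calc ⟪P x, x⟫ ≤ ‖P x‖ * ‖x‖ := real_inner_le_norm _ _
          _ ≤ ‖P‖ * ‖x‖ * ‖x‖ := by gcongr; exact P.le_opNorm _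
          _ ≤ _ := by nlinarith [sq_nonneg ‖x‖]
      have h3 : d / (‖P‖ + 1) * ⟪P x, x⟫ ≤ d * ‖x‖ ^ 2 := by
        calc d / (‖P‖ + 1) * ⟪P x, x⟫ ≤ d / (‖P‖ + 1) * ((‖P‖ + 1) * ‖x‖ ^ 2) := by gcongr
          _ = _ := by field_simp
      rw [sub_mul]
      linarith
    have := csInf_le hSbdd hmem
    have hpos : 0 < d / (‖P‖ + 1) := by positivity
    linarith

end Abstract

/-- The real Hilbert space `ℓ²(ℤ)`. -/
abbrev Space : Type := lp (fun _ : ℤ => ℝ) 2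

theorem hasSum_mul (f g : Space) : HasSum (fun m => f m * g m) ⟪f, g⟫ := by
  have h := lp.hasSum_inner (𝕜 := ℝ) f g
  simpa [mul_comm] using h

theorem norm_sq_eq (f : Space) : HasSum (fun m => f m ^ 2) (‖f‖ ^ 2) := by
  have h := hasSum_mul f f
  rw [real_inner_self_eq_norm_sq] at h
  simpa [sq] using h

theorem memℓp_two_iff {f : ℤ → ℝ} : Memℓp f 2 ↔ Summable fun m => f m ^ 2 := by
  rw [memℓp_gen_iff (by norm_num)]
  simp

theorem memℓp_shift {f : ℤ → ℝ} (hf : Memℓp f 2) (k : ℤ) : Memℓp (fun m => f (m + k)) 2 :=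
  memℓp_two_iff.2 <|
    (Equiv.addRight k).summable_iff (f := fun m => f m ^ 2) |>.2 (memℓp_two_iff.1 hf)

/-- Translation by `k`, as a linear map. -/
def shiftLinear (k : ℤ) : Space →ₗ[ℝ] Space where
  toFun f := ⟨fun m => f (m + k), memℓp_shift (lp.memℓp f) k⟩
  map_add' _ _ := rfl
  map_smul' _ _ := rfl

theorem norm_shiftLinear (k : ℤ) (f : Space) : ‖shiftLinear k f‖ = ‖f‖ := by
  have h : HasSum (fun m => shiftLinear k f m ^ 2) (‖f‖ ^ 2) :=
    (Equiv.addRight k).hasSum_iff (f := fun m => f m ^ 2) |>.2 (norm_sq_eq f)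
  have h' := (norm_sq_eq (shiftLinear k f)).unique h
  rwa [sq_eq_sq₀ (norm_nonneg _) (norm_nonneg _)] at h'

/-- Translation by `k`, as a linear isometry. -/
def shift (k : ℤ) : Space →ₗᵢ[ℝ] Space where
  toLinearMap := shiftLinear k
  norm_map' := norm_shiftLinear k

theorem shift_apply (k : ℤ) (f : Space) (m : ℤ) : shift k f m = f (m + k) := rfl

theorem inner_shift_left (k : ℤ) (f g : Space) : ⟪shift k f, g⟫ = ⟪f, shift (-k) g⟫ := by
  rw [← (shift k).inner_map_map f]
  congr 1
  ext m
  simp [shift_apply]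

theorem norm_mul_le_norm_const_smul {d : ℤ → ℝ} {C : ℝ} (hC : ∀ m, |d m| ≤ C) (f : Space)
    (m : ℤ) :
    ‖d m * f m‖ ≤ ‖(C • f) m‖ := by
  rw [lp.coeFn_smul, Pi.smul_apply, smul_eq_mul, norm_mul, norm_mul]
  gcongr
  exact (hC m).trans (le_abs_self C)

theorem memℓp_mul {d : ℤ → ℝ} {C : ℝ} (hC : ∀ m, |d m| ≤ C) (f : Space) :
    Memℓp (fun m => d m * f m) 2 :=
  (lp.memℓp (C • f)).mono' (norm_mul_le_norm_const_smul hC f)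

/-- Pointwise multiplication by a bounded sequence. -/
noncomputable def diag (d : ℤ → ℝ) {C : ℝ} (hC : ∀ m, |d m| ≤ C) : Space →L[ℝ] Space :=
  LinearMap.mkContinuous
    { toFun := fun f => ⟨fun m => d m * f m, memℓp_mul hC f⟩
      map_add' := fun f g => by ext m; exact mul_add _ _ _
      map_smul' := fun c f => by ext m; exact mul_left_comm _ _ _ }
    ‖C‖ fun f => by
      rw [← norm_smul]
      exact lp.norm_mono (by simp) (norm_mul_le_norm_const_smul hC f)

theorem diag_apply (d : ℤ → ℝ) {C : ℝ} (hd : ∀ m, |d m| ≤ C) (f : Space) (m : ℤ) :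
    diag d hd f m = d m * f m := rfl

theorem inner_diag_left (d : ℤ → ℝ) {C : ℝ} (hd : ∀ m, |d m| ≤ C) (f g : Space) :
    ⟪diag d hd f, g⟫ = ⟪f, diag d hd g⟫ := by
  refine (hasSum_mul _ _).unique ((hasSum_mul _ _).congr_fun ?_)
  intro m
  simp only [diag_apply]
  ring

theorem isCompactOperator_diag (d : ℤ → ℝ) {C : ℝ} (hd : ∀ m, |d m| ≤ C) (s : Finset ℤ)
    (hs : ∀ m ∉ s, d m = 0) : IsCompactOperator (diag d hd) := by
  have hsum : diag d hd = ∑ i ∈ s, (lp.singleContinuousLinearMap ℝ (fun _ : ℤ => ℝ) 2 i).comp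
      (d i • lp.evalCLM ℝ (fun _ : ℤ => ℝ) 2 i) := by
    ext f m
    have hterm : ∀ i, (lp.singleContinuousLinearMap ℝ (fun _ : ℤ => ℝ) 2 i).comp
        (d i • lp.evalCLM ℝ (fun _ : ℤ => ℝ) 2 i) f = lp.single 2 i (d i * f i) := fun _ => rfl
    rw [diag_apply, sum_apply, lp.coeFn_sum, Finset.sum_apply]
    simp only [hterm, lp.single_apply, Finset.sum_pi_single]
    split_ifs with hm
    · rfl
    · rw [hs m hm, zero_mul]
  rw [hsum]
  refine Finset.sum_induction _ (fun T : Space →L[ℝ] Space => IsCompactOperator T)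
    (fun _ _ hS hT => hS.add hT) isCompactOperator_zero fun i _ => ?_
  have h : IsCompactOperator (d i • lp.evalCLM ℝ (fun _ : ℤ => ℝ) 2 i : Space →L[ℝ] ℝ) :=
    isCompactOperator_of_locallyCompactSpace_dom _
  exact h.clm_comp (lp.singleContinuousLinearMap ℝ (fun _ : ℤ => ℝ) 2 i)

/-- The Jacobi operator `f ↦ -ε (f (m + 1) + f (m - 1)) + d m * f m`. -/
noncomputable def jacobi (ε : ℝ) (d : ℤ → ℝ) {C : ℝ} (hd : ∀ m, |d m| ≤ C) : Space →L[ℝ] Space :=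
  -ε • ((shift 1).toContinuousLinearMap + (shift (-1)).toContinuousLinearMap) + diag d hd

theorem jacobi_apply (ε : ℝ) (d : ℤ → ℝ) {C : ℝ} (hd : ∀ m, |d m| ≤ C) (f : Space) (m : ℤ) :
    jacobi ε d hd f m = -ε * (f (m + 1) + f (m - 1)) + d m * f m := rfl

theorem inner_jacobi_left (ε : ℝ) (d : ℤ → ℝ) {C : ℝ} (hd : ∀ m, |d m| ≤ C) (f g : Space) :
    ⟪jacobi ε d hd f, g⟫ = ⟪f, jacobi ε d hd g⟫ := by
  simp only [jacobi, add_apply, smul_apply, LinearIsometry.coe_toContinuousLinearMap,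
    inner_add_left, inner_add_right, real_inner_smul_left, real_inner_smul_right,
    inner_shift_left, inner_diag_left, neg_neg]
  ring

theorem inner_jacobi_self (ε : ℝ) (d : ℤ → ℝ) {C : ℝ} (hd : ∀ m, |d m| ≤ C) (f : Space) :
    ⟪jacobi ε d hd f, f⟫ = ⟪diag d hd f, f⟫ - 2 * ε * ⟪shift 1 f, f⟫ := by
  have h : ⟪shift (-1) f, f⟫ = ⟪shift 1 f, f⟫ := by
    rw [inner_shift_left, neg_neg, real_inner_comm]
  simp only [jacobi, add_apply, smul_apply, LinearIsometry.coe_toContinuousLinearMap,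
    inner_add_left, real_inner_smul_left, h]
  ring

theorem inner_shift_self_le (k : ℤ) (f : Space) : ⟪shift k f, f⟫ ≤ ‖f‖ ^ 2 := by
  calc ⟪shift k f, f⟫ ≤ ‖shift k f‖ * ‖f‖ := real_inner_le_norm _ _
    _ = ‖f‖ ^ 2 := by rw [LinearIsometry.norm_map, sq]

theorem le_inner_diag_self (d : ℤ → ℝ) {C : ℝ} (hd : ∀ m, |d m| ≤ C) {c : ℝ} (hc : ∀ m, c ≤ d m)
    (f : Space) :
    c * ‖f‖ ^ 2 ≤ ⟪diag d hd f, f⟫ := by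
  refine hasSum_le (fun m => ?_) ((norm_sq_eq f).mul_left c) (hasSum_mul _ _)
  rw [diag_apply]
  nlinarith [mul_le_mul_of_nonneg_right (hc m) (sq_nonneg (f m))]

theorem inner_jacobi_self_nonneg {ε : ℝ} (hε : 0 ≤ ε) (d : ℤ → ℝ) {C : ℝ} (hd : ∀ m, |d m| ≤ C)
    (h : ∀ m, 2 * ε ≤ d m) (f : Space) : 0 ≤ ⟪jacobi ε d hd f, f⟫ := by
  rw [inner_jacobi_self]
  nlinarith [le_inner_diag_self d hd h f, mul_le_mul_of_nonneg_left (inner_shift_self_le 1 f) hε]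

/-- A Jacobi operator with a positive solution of `J ψ = c ψ` is bounded below by `c`
(ground state representation). -/
theorem le_inner_jacobi_self {ε : ℝ} (hε : 0 < ε) (d : ℤ → ℝ) {C : ℝ} (hd : ∀ m, |d m| ≤ C)
    {ψ : ℤ → ℝ}
    (hψ : ∀ m, 0 < ψ m) {c : ℝ} (hJ : ∀ m, -ε * (ψ (m + 1) + ψ (m - 1)) + d m * ψ m = c * ψ m)
    (f : Space) : c * ‖f‖ ^ 2 ≤ ⟪jacobi ε d hd f, f⟫ := by
  have hratio : ∀ m, ε * (ψ (m + 1) / ψ m) + ε * (ψ (m - 1) / ψ m) = d m - c := fun m => by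
    have := (hψ m).ne'
    field_simp
    linarith [hJ m]
  have hD' : ∀ m, d m ≤ C := fun m => (le_abs_self _).trans (hd m)
  have hbdd : ∀ k : ℤ, k = 1 ∨ k = -1 → ∀ m, |ψ (m + k) / ψ m| ≤ (C - c) / ε :=
    fun k hk m => by
    have hp : 0 < ψ (m + 1) / ψ m := div_pos (hψ _) (hψ _)
    have hq : 0 < ψ (m - 1) / ψ m := div_pos (hψ _) (hψ _)
    have hr := hratio m
    have hDm := hD' m
    rw [abs_of_nonneg (div_pos (hψ _) (hψ _)).le, le_div_iff₀ hε]
    rcases hk with rfl | rfl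
    · nlinarith [mul_pos hε hq]
    · rw [← sub_eq_add_neg]
      nlinarith [mul_pos hε hp]
  set R := diag (fun m => ψ (m + 1) / ψ m) (hbdd 1 (Or.inl rfl)) with hR
  set R' := diag (fun m => ψ (m + -1) / ψ m) (hbdd (-1) (Or.inr rfl)) with hR'
  have hsplit : ⟪diag d hd f, f⟫ = c * ‖f‖ ^ 2 + ε * (⟪R f, f⟫ + ⟪R' f, f⟫) := by
    refine (hasSum_mul _ _).unique ?_
    refine (((norm_sq_eq f).mul_left c).add
      (((hasSum_mul (R f) f).add (hasSum_mul (R' f) f)).mul_left ε)).congr_fun fun m => ?_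
    simp only [hR, hR', diag_apply, ← sub_eq_add_neg]
    linear_combination (-(f m) ^ 2) * hratio m
  have hmain : 0 ≤ ⟪R f, f⟫ + ⟪shift 1 (R' f), shift 1 f⟫ - 2 * ⟪shift 1 f, f⟫ := by
    refine HasSum.nonneg (fun m => ?_) (((hasSum_mul (R f) f).add
      (hasSum_mul (shift 1 (R' f)) (shift 1 f))).sub ((hasSum_mul (shift 1 f) f).mul_left 2))
    simp only [hR, hR', diag_apply, shift_apply, add_neg_cancel_right]
    have h0 := hψ m
    have h1 := hψ (m + 1)
    have : ψ (m + 1) / ψ m * f m * f m + ψ m / ψ (m + 1) * f (m + 1) * f (m + 1)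
        - 2 * (f (m + 1) * f m)
        = (ψ (m + 1) * f m - ψ m * f (m + 1)) ^ 2 / (ψ m * ψ (m + 1)) := by
      field_simp
      ring
    rw [this]
    positivity
  rw [LinearIsometry.inner_map_map] at hmain
  rw [inner_jacobi_self, hsplit]
  nlinarith [mul_nonneg hε.le hmain]

/-- A positive `ℓ²` solution `ψ` of the stationary equation is linearly unstable after shifting both
linearization operators by any `s ∈ (0, 2)`. -/
theorem exists_unstable_mode {ε : ℝ} (hε : 0 < ε) {ψ : ℤ → ℝ} (hψ : Memℓp ψ 2)
    (hpos : ∀ m, 0 < ψ m)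
    (heq : ∀ m, -ψ m + ε * (ψ (m + 1) + ψ (m - 1) - 2 * ψ m) + ψ m ^ 3 = 0)
    {s : ℝ} (hs0 : 0 < s) (hs2 : s < 2) :
    ∃ l : ℝ, 0 < l ∧ ∃ U W : Space, W ≠ 0 ∧
      (∀ m, -ε * (U (m + 1) + U (m - 1)) + (2 * ε + 1 + s - 3 * ψ m ^ 2) * U m = -l * W m) ∧
      (∀ m, -ε * (W (m + 1) + W (m - 1)) + (2 * ε + 1 + s - ψ m ^ 2) * W m = l * U m) := by
  let Ψ : Space := ⟨ψ, hψ⟩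
  have hΨ : ∀ m, Ψ m = ψ m := fun _ => rfl
  set B : ℝ := ‖Ψ‖ with hB
  have hψB : ∀ m, ψ m ^ 2 ≤ B ^ 2 := fun m =>
    pow_le_pow_left₀ (hpos m).le ((le_abs_self _).trans (lp.norm_apply_le_norm (by simp) Ψ m)) 2
  have hΨpos : 0 < ‖Ψ‖ ^ 2 := lt_of_lt_of_le (pow_pos (hpos 0) 2) (hψB 0)
  set C : ℝ := 2 * ε + 1 + s + 3 * B ^ 2 with hC
  have hdL : ∀ m, |2 * ε + 1 + s - 3 * ψ m ^ 2| ≤ C := fun m => by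
    rw [abs_le]; constructor <;> nlinarith [hψB m, sq_nonneg (ψ m)]
  have hdP : ∀ m, |2 * ε + 1 + s - ψ m ^ 2| ≤ C := fun m => by
    rw [abs_le]; constructor <;> nlinarith [hψB m, sq_nonneg (ψ m)]
  have hdD : ∀ m, |ψ m ^ 2| ≤ B ^ 2 := fun m => by
    rw [abs_of_nonneg (sq_nonneg _)]; exact hψB m
  have hdK : ∀ m, |if 1 < 3 * ψ m ^ 2 then 3 * ψ m ^ 2 else 0| ≤ C := fun m => by
    split_ifs <;> rw [abs_le] <;> constructor <;> nlinarith [hψB m, sq_nonneg (ψ m)]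
  have hdA : ∀ m, |2 * ε + 1 + s - if 1 < 3 * ψ m ^ 2 then 0 else 3 * ψ m ^ 2| ≤ C := fun m => by
    split_ifs <;> rw [abs_le] <;> constructor <;> nlinarith [hψB m, sq_nonneg (ψ m)]
  have hdE : ∀ _ : ℤ, |2 * ε| ≤ 2 * ε := fun _ => (abs_of_pos (by positivity)).le
  have hfin : {m | 1 < 3 * ψ m ^ 2}.Finite := by
    have h := (memℓp_two_iff.1 hψ).tendsto_cofinite_zero.eventually_lt_const
      (show (0 : ℝ) < 1 / 3 by norm_num)
    refine (Filter.eventually_cofinite.1 h).subset fun m hm => ?_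
    rw [Set.mem_ofPred_eq] at hm ⊢
    linarith
  have hAK : jacobi ε _ hdA - diag _ hdK = jacobi ε _ hdL := by
    ext f m
    rw [sub_apply, lp.coeFn_sub, Pi.sub_apply, jacobi_apply, jacobi_apply, diag_apply]
    split_ifs <;> ring
  have hPΨ : jacobi ε _ hdP Ψ = s • Ψ := by
    ext m
    rw [jacobi_apply, lp.coeFn_smul, Pi.smul_apply, smul_eq_mul, hΨ, hΨ, hΨ]
    linear_combination -heq m
  have hLΨ : jacobi ε _ hdL Ψ = s • Ψ - (2 : ℝ) • diag _ hdD Ψ := by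
    ext m
    rw [jacobi_apply, lp.coeFn_sub, Pi.sub_apply, lp.coeFn_smul, lp.coeFn_smul, Pi.smul_apply,
      Pi.smul_apply, smul_eq_mul, smul_eq_mul, diag_apply, hΨ, hΨ, hΨ]
    linear_combination -heq m
  have hEΨ : jacobi ε _ hdE Ψ = diag _ hdD Ψ - Ψ := by
    ext m
    rw [jacobi_apply, lp.coeFn_sub, Pi.sub_apply, diag_apply, hΨ, hΨ, hΨ]
    linear_combination -heq m
  have hquartic : ‖Ψ‖ ^ 2 ≤ ⟪diag _ hdD Ψ, Ψ⟫ := by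
    have h := inner_jacobi_self_nonneg hε.le _ hdE (fun _ => le_rfl) Ψ
    rw [hEΨ, inner_sub_left, real_inner_self_eq_norm_sq] at h
    linarith
  obtain ⟨l, hl, U, W, hW, hU1, hW1⟩ := exists_hamiltonian_eigenvalue
    (A := jacobi ε _ hdA) (K := diag _ hdK) (P := jacobi ε _ hdP)
    (inner_jacobi_self_nonneg hε.le _ hdA fun m => by split_ifs <;> linarith)
    (isCompactOperator_diag _ hdK hfin.toFinset fun m hm => if_neg (by simpa using hm))
    (by rw [hAK]; exact inner_jacobi_left _ _ _) (inner_jacobi_left _ _ _)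
    ⟨s, hs0, le_inner_jacobi_self hε _ hdP hpos fun m => by linear_combination -heq m⟩
    ⟨Ψ, by
      rw [hAK, hPΨ, map_smul, real_inner_smul_left, real_inner_smul_right, hLΨ, inner_sub_left,
        real_inner_smul_left, real_inner_smul_left, real_inner_self_eq_norm_sq]
      have h : s * ‖Ψ‖ ^ 2 - 2 * ⟪diag _ hdD Ψ, Ψ⟫ < 0 := by nlinarith
      exact mul_neg_of_pos_of_neg hs0 (mul_neg_of_pos_of_neg hs0 h)⟩
  rw [hAK] at hU1
  refine ⟨l, hl, U, W, hW, fun m => ?_, fun m => ?_⟩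
  · rw [← jacobi_apply ε _ hdL, hU1]; rfl
  · rw [← jacobi_apply ε _ hdP, hW1]; rfl

end LatticeL2

/-- Theorem 1 (transverse instability of the line soliton bifurcating from the Γ
point). For `μ = 1` and any `ε > 0`, given a positive solution `ψ` of the stationary
1D dNLS equation whose linearization `L₊(0)` has exactly one negative eigenvalue and
trivial kernel (encoded: there is an eigenvector `φ` with negative eigenvalue `-β`,
and the quadratic form of `L₊(0)` is strictly positive on nonzero vectors orthogonal
to `φ`), there exists `p₀ ∈ (0,π]` such that for every transverse wavenumber `p` with
`0 < |p| < p₀`, the linear-stability problem `L₊(p)U = -λW`, `L₋(p)W = λU` admits a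
real eigenvalue `λ > 0`; moreover one may take `p₀ = π` when `0 < ε < 1/2`. -/
theorem transverse_instability_Gamma_point (ε : ℝ) (hε : 0 < ε)
    (ψ : ℤ → ℝ) (hψ : Memℓp ψ 2) (hpos : ∀ m : ℤ, 0 < ψ m)
    (heq : ∀ m : ℤ, -ψ m + ε * (ψ (m + 1) + ψ (m - 1) - 2 * ψ m) + (ψ m) ^ 3 = 0)
    (Lplus Lminus : ℝ → (ℤ → ℝ) → ℤ → ℝ)
    (hLp : Lplus = fun p U m =>
      -ε * (U (m + 1) + U (m - 1) + 2 * Real.cos p * U m - 4 * U m)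
        + U m - 3 * (ψ m) ^ 2 * U m)
    (hLm : Lminus = fun p W m =>
      -ε * (W (m + 1) + W (m - 1) + 2 * Real.cos p * W m - 4 * W m)
        + W m - (ψ m) ^ 2 * W m)
    (hone : ∃ φ : ℤ → ℝ, Memℓp φ 2 ∧ φ ≠ 0 ∧
      (∃ β : ℝ, 0 < β ∧ ∀ m : ℤ, Lplus 0 φ m = -β * φ m) ∧
      (∀ U : ℤ → ℝ, Memℓp U 2 → U ≠ 0 → (∑' m : ℤ, φ m * U m) = 0 →
        0 < ∑' m : ℤ, Lplus 0 U m * U m)) :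
    ∃ p₀ : ℝ, p₀ ∈ Set.Ioc 0 Real.pi ∧
      (∀ p : ℝ, 0 < |p| → |p| < p₀ →
        ∃ lam : ℝ, 0 < lam ∧ ∃ U W : ℤ → ℝ, Memℓp U 2 ∧ Memℓp W 2 ∧
          ¬(U = 0 ∧ W = 0) ∧
          (∀ m : ℤ, Lplus p U m = -lam * W m) ∧
          (∀ m : ℤ, Lminus p W m = lam * U m)) ∧
      (ε < 1 / 2 → p₀ = Real.pi) := by
  subst hLp hLm
  have hmode : ∀ p : ℝ, 0 < 2 * ε * (1 - Real.cos p) → 2 * ε * (1 - Real.cos p) < 2 →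
      ∃ lam : ℝ, 0 < lam ∧ ∃ U W : ℤ → ℝ, Memℓp U 2 ∧ Memℓp W 2 ∧ ¬(U = 0 ∧ W = 0) ∧
        (∀ m : ℤ, -ε * (U (m + 1) + U (m - 1) + 2 * Real.cos p * U m - 4 * U m)
          + U m - 3 * (ψ m) ^ 2 * U m = -lam * W m) ∧
        (∀ m : ℤ, -ε * (W (m + 1) + W (m - 1) + 2 * Real.cos p * W m - 4 * W m)
          + W m - (ψ m) ^ 2 * W m = lam * U m) := by
    intro p h0 h2
    obtain ⟨l, hl, U, W, hW, hU1, hW1⟩ := LatticeL2.exists_unstable_mode hε hψ hpos heq h0 h2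
    exact ⟨l, hl, U, W, lp.memℓp U, lp.memℓp W, fun h => hW (lp.ext h.2),
      fun m => by linear_combination hU1 m, fun m => by linear_combination hW1 m⟩
  have hcos : ∀ p : ℝ, 0 < |p| → |p| < Real.pi → 0 < 2 * ε * (1 - Real.cos p) := by
    intro p h0 hpi
    have h := Real.cos_lt_cos_of_nonneg_of_le_pi le_rfl hpi.le h0
    rw [Real.cos_zero, Real.cos_abs] at h
    exact mul_pos (by positivity) (sub_pos.2 h)
  by_cases hhalf : ε < 1 / 2
  · refine ⟨Real.pi, ⟨Real.pi_pos, le_rfl⟩, fun p h0 hp => hmode p (hcos p h0 hp) ?_, fun _ => rfl⟩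
    nlinarith [Real.neg_one_le_cos p]
  · refine ⟨min Real.pi (√(1 / ε)), ⟨lt_min Real.pi_pos (by positivity), min_le_left _ _⟩,
      fun p h0 hp => hmode p (hcos p h0 (hp.trans_le (min_le_left _ _))) ?_,
      fun h => absurd h hhalf⟩
    have hsq : p ^ 2 < 1 / ε := by
      rw [← sq_abs, ← Real.lt_sqrt (abs_nonneg p)]
      exact hp.trans_le (min_le_right _ _)
    rw [lt_div_iff₀ hε] at hsq
    nlinarith [Real.one_sub_sq_div_two_le_cos (x := p)]
end

section
/- (Theorem 1, asymptotic expansion of the unstable eigenvalue.) Let e_j ∈ l²(ℤ, ℝ) denote the Kronecker delta sequence at site j. There exist ε₀ > 0 and C > 0 such that for every ε ∈ (0, ε₀), every p ∈ [−π, π], and every solution ψ ∈ l²(ℤ, ℝ) of the stationary 1D dNLS equation with μ = 1 satisfying ψ_m > 0 for all m and ‖ψ − e₀‖_{l²} ≤ 2ε, there exist λ ∈ ℂ and a nonzero pair (U, W) ∈ l²(ℤ, ℂ)² with L₊(p)U = −λW, L₋(p)W = λU (Γ-point operators with μ = 1), such that |λ² − 8ε sin²(p/2)| ≤ Cε². 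-/
open scoped BoundedContinuousFunction

/-- A linear map close to the negative of the projection `x ↦ x - φ x • e` has a real eigenvalue
close to `φ (T e)`, up to an error quadratic in the distance. -/
theorem exists_eigenvalue_near_of_norm_le {X : Type*} [NormedAddCommGroup X] [NormedSpace ℝ X]
    [CompleteSpace X] (T : X →ₗ[ℝ] X) (φ : X →ₗ[ℝ] ℝ) (e : X) (s : ℝ)
    (hφe : φ e = 1) (he : ‖e‖ ≤ 1) (hφ : ∀ x, |φ x| ≤ ‖x‖)
    (hT : ∀ x, ‖T x + x - φ x • e‖ ≤ s * ‖x‖) (hs₀ : 0 ≤ s) (hs : s ≤ 1 / 10) :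
    ∃ (x : X) (Λ : ℝ), φ x = 1 ∧ T x = Λ • x ∧ |Λ - φ (T e)| ≤ 6 * s ^ 2 := by
  set S : X →ₗ[ℝ] X := T + LinearMap.id - φ.smulRight e with hSdef
  have hSx : ∀ x, S x = T x + x - φ x • e := fun x => by simp [hSdef]
  have hS : ∀ x, ‖S x‖ ≤ s * ‖x‖ := fun x => by rw [hSx]; exact hT x
  have hφS : ∀ x, |φ (S x)| ≤ s * ‖x‖ := fun x => (hφ _).trans (hS x)
  let G : X → X := fun x => e + S x - φ (S x) • x
  have hball : ∀ x ∈ Metric.closedBall e 1, ‖x‖ ≤ 2 := by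
    intro x hx
    have h1 : ‖x - e‖ ≤ 1 := by simpa [dist_eq_norm] using hx
    have h2 := norm_add_le (x - e) e
    rw [sub_add_cancel] at h2
    linarith
  have hGe : ∀ x ∈ Metric.closedBall e 1, ‖G x - e‖ ≤ 6 * s := by
    intro x hx
    have hx2 := hball x hx
    have h1 : G x - e = S x - φ (S x) • x := by simp only [G]; abel
    have h2 := norm_sub_le (S x) (φ (S x) • x)
    rw [norm_smul, Real.norm_eq_abs] at h2
    have h3 : |φ (S x)| * ‖x‖ ≤ (s * 2) * 2 :=
      mul_le_mul ((hφS x).trans (by gcongr)) hx2 (norm_nonneg _) (by positivity)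
    have h4 : ‖S x‖ ≤ s * 2 := (hS x).trans (by gcongr)
    rw [h1]
    linarith
  have hmaps : Set.MapsTo G (Metric.closedBall e 1) (Metric.closedBall e 1) := by
    intro x hx
    have := hGe x hx
    rw [Metric.mem_closedBall, dist_eq_norm]
    linarith
  have hlip : LipschitzOnWith (1 / 2) G (Metric.closedBall e 1) := by
    refine LipschitzOnWith.of_dist_le_mul fun x hx y hy => ?_
    rw [dist_eq_norm, dist_eq_norm]
    have hx2 := hball x hx
    have hy2 := hball y hy
    have h1 : G x - G y = S (x - y) - φ (S (x - y)) • x - φ (S y) • (x - y) := by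
      simp only [G, map_sub, sub_smul, smul_sub]
      abel
    have h2 := norm_sub_le (S (x - y) - φ (S (x - y)) • x) (φ (S y) • (x - y))
    have h3 := norm_sub_le (S (x - y)) (φ (S (x - y)) • x)
    rw [norm_smul, Real.norm_eq_abs] at h2 h3
    have h4 : |φ (S (x - y))| * ‖x‖ ≤ (s * ‖x - y‖) * 2 :=
      mul_le_mul (hφS _) hx2 (norm_nonneg _) (by positivity)
    have h5 : |φ (S y)| * ‖x - y‖ ≤ (s * 2) * ‖x - y‖ :=
      mul_le_mul_of_nonneg_right ((hφS y).trans (by gcongr)) (norm_nonneg _)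
    have h6 := hS (x - y)
    have h7 : s * ‖x - y‖ ≤ 1 / 10 * ‖x - y‖ := by gcongr
    rw [h1]
    push_cast
    linarith
  have hcontr : ContractingWith (1 / 2) (hmaps.restrict G _ _) := by
    exact ⟨by rw [← NNReal.coe_lt_coe]; norm_num, fun x y => hlip x.2 y.2⟩
  obtain ⟨x, hx, hfix, -⟩ := hcontr.exists_fixedPoint' Metric.isClosed_closedBall.isComplete hmaps
    (Metric.mem_closedBall_self zero_le_one) (edist_ne_top _ _)
  have hGx : e + S x - φ (S x) • x = x := hfix
  have hxe : ‖x - e‖ ≤ 6 * s := by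
    have := hGe x hx
    rwa [hfix.eq] at this
  have hΛ : |φ (S x)| ≤ 1 / 5 :=
    (hφS x).trans (by nlinarith [hball x hx, norm_nonneg x])
  have hφx : φ x = 1 := by
    have h := congrArg φ hGx
    simp only [map_add, map_sub, map_smul, hφe, smul_eq_mul] at h
    have h0 : (1 + φ (S x)) ≠ 0 := by
      have := (abs_le.1 hΛ).1
      linarith
    exact mul_left_cancel₀ h0 (by linarith)
  refine ⟨x, φ (S x), hφx, ?_, ?_⟩
  · have h : e + (T x + x - φ x • e) - φ (S x) • x = x := by rw [← hSx]; exact hGx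
    rw [hφx, one_smul] at h
    have h' : T x = (e + (T x + x - e) - φ (S x) • x) - x + φ (S x) • x := by abel
    rw [h, sub_self, zero_add] at h'
    exact h'
  · have h1 : φ (T e) = φ (S e) := by simp [hSx, hφe]
    rw [h1, ← map_sub, ← map_sub]
    refine (hφS _).trans ?_
    calc s * ‖x - e‖ ≤ s * (6 * s) := by gcongr
      _ = 6 * s ^ 2 := by ring

/-- The exponential weight `2 ^ (-|m|)`. -/
noncomputable def expWeight (m : ℤ) : ℝ := (1 / 2) ^ m.natAbs

theorem expWeight_pos (m : ℤ) : 0 < expWeight m := by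
  unfold expWeight
  positivity

theorem expWeight_add_one_le (m : ℤ) : expWeight (m + 1) ≤ 2 * expWeight m := by
  have h : m.natAbs ≤ (m + 1).natAbs + 1 := by omega
  have := pow_le_pow_of_le_one (by norm_num : (0 : ℝ) ≤ 1 / 2) (by norm_num) h
  rw [pow_succ] at this
  unfold expWeight
  linarith

theorem expWeight_sub_one_le (m : ℤ) : expWeight (m - 1) ≤ 2 * expWeight m := by
  have h : m.natAbs ≤ (m - 1).natAbs + 1 := by omega
  have := pow_le_pow_of_le_one (by norm_num : (0 : ℝ) ≤ 1 / 2) (by norm_num) h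
  rw [pow_succ] at this
  unfold expWeight
  linarith

theorem abs_expWeight_add_one_div_le (m : ℤ) : |expWeight (m + 1) / expWeight m| ≤ 2 := by
  rw [abs_of_pos (div_pos (expWeight_pos _) (expWeight_pos _)), div_le_iff₀ (expWeight_pos _)]
  exact expWeight_add_one_le m

theorem abs_expWeight_sub_one_div_le (m : ℤ) : |expWeight (m - 1) / expWeight m| ≤ 2 := by
  rw [abs_of_pos (div_pos (expWeight_pos _) (expWeight_pos _)), div_le_iff₀ (expWeight_pos _)]
  exact expWeight_sub_one_le m

theorem memℓp_two_of_norm_le_expWeight {f : ℤ → ℂ} {c : ℝ}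
    (hf : ∀ m, ‖f m‖ ≤ c * expWeight m) : Memℓp f 2 := by
  refine (memℓp_gen_iff (by norm_num)).2 ?_
  have hg : Summable fun m : ℤ => c ^ 2 * (expWeight m) ^ 2 := by
    refine Summable.mul_left _ ?_
    have h : Summable fun n : ℕ => (((1 : ℝ) / 2) ^ n) ^ 2 := by
      have := summable_geometric_of_lt_one (by norm_num : (0 : ℝ) ≤ 1 / 4) (by norm_num)
      refine this.congr fun n => ?_
      rw [← pow_mul, mul_comm, pow_mul]
      norm_num
    refine Summable.of_nat_of_neg ?_ ?_ <;> simpa [expWeight] using h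
  refine Summable.of_nonneg_of_le (fun m => by positivity) (fun m => ?_) hg
  have h := pow_le_pow_left₀ (norm_nonneg _) (hf m) 2
  rw [mul_pow] at h
  simpa using h

/-- The operator `f ↦ -ε (f (m + 1) + f (m - 1)) + a m * f m` on exponentially decaying sequences
`f m = 2 ^ (-|m|) * v m`, written in terms of the bounded sequence `v`. -/
noncomputable def weightedTridiagonal (ε : ℝ) (a : ℤ →ᵇ ℝ) : (ℤ →ᵇ ℝ) →ₗ[ℝ] (ℤ →ᵇ ℝ) where
  toFun v := BoundedContinuousFunction.ofNormedAddCommGroupDiscrete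
    (fun m => -ε * (expWeight (m + 1) / expWeight m * v (m + 1)
      + expWeight (m - 1) / expWeight m * v (m - 1)) + a m * v m)
    (|ε| * (2 * ‖v‖ + 2 * ‖v‖) + ‖a‖ * ‖v‖) (fun m => by
      have h1 := abs_expWeight_add_one_div_le m
      have h2 := abs_expWeight_sub_one_div_le m
      refine (norm_add_le _ _).trans ?_
      rw [norm_mul, norm_mul, norm_neg, Real.norm_eq_abs ε]
      gcongr
      · refine (norm_add_le _ _).trans ?_
        rw [norm_mul, norm_mul, Real.norm_eq_abs (_ / _), Real.norm_eq_abs (_ / _)]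
        gcongr <;> exact v.norm_coe_le_norm _
      · exact a.norm_coe_le_norm _
      · exact v.norm_coe_le_norm _)
  map_add' v w := by ext m; simp; ring
  map_smul' c v := by ext m; simp; ring

theorem weightedTridiagonal_apply (ε : ℝ) (a v : ℤ →ᵇ ℝ) (m : ℤ) :
    weightedTridiagonal ε a v m = -ε * (expWeight (m + 1) / expWeight m * v (m + 1)
      + expWeight (m - 1) / expWeight m * v (m - 1)) + a m * v m := rfl

theorem expWeight_mul_weightedTridiagonal (ε : ℝ) (a v : ℤ →ᵇ ℝ) (m : ℤ) :
    expWeight m * weightedTridiagonal ε a v m =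
      -ε * (expWeight (m + 1) * v (m + 1) + expWeight (m - 1) * v (m - 1))
        + a m * (expWeight m * v m) := by
  rw [weightedTridiagonal_apply]
  have := (expWeight_pos m).ne'
  field_simp

theorem abs_weightedTridiagonal_sub_le {ε : ℝ} (hε : 0 ≤ ε) (a v : ℤ →ᵇ ℝ) (m : ℤ) :
    |weightedTridiagonal ε a v m - a m * v m| ≤ 4 * ε * ‖v‖ := by
  have h1 := abs_expWeight_add_one_div_le m
  have h2 := abs_expWeight_sub_one_div_le m
  have h3 : |expWeight (m + 1) / expWeight m * v (m + 1)
      + expWeight (m - 1) / expWeight m * v (m - 1)| ≤ 2 * ‖v‖ + 2 * ‖v‖ := by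
    refine (abs_add_le _ _).trans ?_
    rw [abs_mul, abs_mul]
    gcongr <;> exact v.norm_coe_le_norm _
  rw [weightedTridiagonal_apply, add_sub_cancel_right, abs_mul, abs_neg, abs_of_nonneg hε]
  nlinarith

/-- The Kronecker delta at the origin as a bounded sequence. -/
noncomputable def deltaZero : ℤ →ᵇ ℝ :=
  BoundedContinuousFunction.ofNormedAddCommGroupDiscrete (fun m => if m = 0 then 1 else 0) 1
    (fun m => by split_ifs <;> simp)

theorem deltaZero_apply (m : ℤ) : deltaZero m = if m = 0 then 1 else 0 := rfl

/-- Evaluation at the origin. -/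
noncomputable def evalZero : (ℤ →ᵇ ℝ) →ₗ[ℝ] ℝ where
  toFun v := v 0
  map_add' _ _ := rfl
  map_smul' _ _ := rfl

theorem evalZero_apply (v : ℤ →ᵇ ℝ) : evalZero v = v 0 := rfl

theorem norm_neg_comp_add_sub_le {ε : ℝ} (hε : 0 ≤ ε) (hε' : ε ≤ 1 / 1000) (a b : ℤ →ᵇ ℝ)
    (ha : ∀ m, |a m - if m = 0 then 0 else 1| ≤ 11 * ε)
    (hb : ∀ m, |b m - if m = 0 then -2 else 1| ≤ 21 * ε) (x : ℤ →ᵇ ℝ) :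
    ‖-(weightedTridiagonal ε b (weightedTridiagonal ε a x)) + x - evalZero x • deltaZero‖
      ≤ 80 * ε * ‖x‖ := by
  set h := weightedTridiagonal ε a x with hh
  have hN := norm_nonneg x
  have hεN : 0 ≤ ε * ‖x‖ := by positivity
  have hd : ∀ m, |h m - (if m = 0 then 0 else 1) * x m| ≤ 15 * ε * ‖x‖ := by
    intro m
    have h1 := abs_weightedTridiagonal_sub_le hε a x m
    have h2 : |(a m - if m = 0 then 0 else 1) * x m| ≤ 11 * ε * ‖x‖ := by
      rw [abs_mul]
      exact mul_le_mul (ha m) (x.norm_coe_le_norm m) (abs_nonneg _) (by positivity)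
    have h3 : h m - (if m = 0 then 0 else 1) * x m =
        (h m - a m * x m) + (a m - if m = 0 then 0 else 1) * x m := by ring
    rw [h3]
    refine (abs_add_le _ _).trans ?_
    rw [hh]
    linarith
  have hn : ‖h‖ ≤ 2 * ‖x‖ := by
    refine (BoundedContinuousFunction.norm_le (by positivity)).2 fun m => ?_
    have h1 := hd m
    have h2 : |(if m = 0 then (0 : ℝ) else 1) * x m| ≤ ‖x‖ := by
      split_ifs
      · simp
      · simpa using x.norm_coe_le_norm m
    have h3 := abs_add_le (h m - (if m = 0 then 0 else 1) * x m) ((if m = 0 then 0 else 1) * x m)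
    rw [sub_add_cancel] at h3
    rw [Real.norm_eq_abs]
    nlinarith
  refine (BoundedContinuousFunction.norm_le (by positivity)).2 fun m => ?_
  have h1 := abs_weightedTridiagonal_sub_le hε b h m
  have h1' : 4 * ε * ‖h‖ ≤ 4 * ε * (2 * ‖x‖) := by gcongr
  have h2 : |(b m - if m = 0 then -2 else 1) * h m| ≤ 21 * ε * (2 * ‖x‖) := by
    rw [abs_mul]
    exact mul_le_mul (hb m) ((h.norm_coe_le_norm m).trans hn) (abs_nonneg _) (by positivity)
  have h3 : |(if m = 0 then (-2 : ℝ) else 1) * (h m - (if m = 0 then 0 else 1) * x m)|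
      ≤ 2 * (15 * ε * ‖x‖) := by
    rw [abs_mul]
    refine mul_le_mul ?_ (hd m) (abs_nonneg _) (by norm_num)
    split_ifs <;> norm_num
  have h4 : (-(weightedTridiagonal ε b h) + x - evalZero x • deltaZero) m =
      -((weightedTridiagonal ε b h m - b m * h m) + (b m - if m = 0 then -2 else 1) * h m
        + (if m = 0 then (-2 : ℝ) else 1) * (h m - (if m = 0 then 0 else 1) * x m)) := by
    simp only [BoundedContinuousFunction.coe_sub, BoundedContinuousFunction.coe_add,
      BoundedContinuousFunction.coe_neg, BoundedContinuousFunction.coe_smul, Pi.add_apply,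
      Pi.sub_apply, Pi.neg_apply, evalZero_apply, deltaZero_apply, smul_eq_mul]
    split_ifs with hm
    · subst hm; ring
    · ring
  rw [h4, Real.norm_eq_abs, abs_neg]
  refine (abs_add_three _ _ _).trans ?_
  linarith

theorem exists_eigenvector_neg_comp {ε : ℝ} (hε : 0 ≤ ε) (hε' : ε ≤ 1 / 1000) (a b : ℤ → ℝ)
    (ha : ∀ m, |a m - if m = 0 then 0 else 1| ≤ 11 * ε)
    (hb : ∀ m, |b m - if m = 0 then -2 else 1| ≤ 21 * ε) :
    ∃ (W Z : ℤ → ℝ) (Λ c : ℝ), W 0 = 1 ∧ (∀ m, |W m| ≤ c * expWeight m) ∧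
      (∀ m, |Z m| ≤ c * expWeight m) ∧
      (∀ m, -ε * (W (m + 1) + W (m - 1)) + a m * W m = Z m) ∧
      (∀ m, -ε * (Z (m + 1) + Z (m - 1)) + b m * Z m = -Λ * W m) ∧
      |Λ + 2 * ε ^ 2 + b 0 * a 0| ≤ 38400 * ε ^ 2 := by
  let A : ℤ →ᵇ ℝ := BoundedContinuousFunction.ofNormedAddCommGroupDiscrete a 2 fun m => by
    have h := abs_le.1 (ha m)
    rw [Real.norm_eq_abs, abs_le]
    split_ifs at h <;> constructor <;> linarith
  let B : ℤ →ᵇ ℝ := BoundedContinuousFunction.ofNormedAddCommGroupDiscrete b 3 fun m => by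
    have h := abs_le.1 (hb m)
    rw [Real.norm_eq_abs, abs_le]
    split_ifs at h <;> constructor <;> linarith
  obtain ⟨x, Λ, hx0, hTx, hΛ⟩ := exists_eigenvalue_near_of_norm_le
    (-(weightedTridiagonal ε B ∘ₗ weightedTridiagonal ε A)) evalZero deltaZero (80 * ε)
    (by simp [evalZero_apply, deltaZero_apply])
    ((BoundedContinuousFunction.norm_le zero_le_one).2 fun m => by
      rw [deltaZero_apply]; split_ifs <;> simp)
    (fun x => x.norm_coe_le_norm 0)
    (norm_neg_comp_add_sub_le hε hε' A B ha hb) (by positivity) (by linarith)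
  set z := weightedTridiagonal ε A x with hz
  have hbound : ∀ v : ℤ →ᵇ ℝ, ‖v‖ ≤ ‖x‖ + ‖z‖ → ∀ m,
      |expWeight m * v m| ≤ (‖x‖ + ‖z‖) * expWeight m := by
    intro v hv m
    rw [abs_mul, abs_of_pos (expWeight_pos m), mul_comm]
    exact mul_le_mul_of_nonneg_right ((v.norm_coe_le_norm m).trans hv) (expWeight_pos m).le
  refine ⟨fun m => expWeight m * x m, fun m => expWeight m * z m, Λ, ‖x‖ + ‖z‖, ?_,
    hbound x (by linarith [norm_nonneg z]), hbound z (by linarith [norm_nonneg x]),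
    fun m => (expWeight_mul_weightedTridiagonal ε A x m).symm, fun m => ?_, ?_⟩
  · rw [evalZero_apply] at hx0
    simp [hx0, expWeight]
  · have h1 : -(weightedTridiagonal ε B z m) = Λ * x m := congrArg (fun v : ℤ →ᵇ ℝ => v m) hTx
    have h2 := expWeight_mul_weightedTridiagonal ε B z m
    change -ε * (expWeight (m + 1) * z (m + 1) + expWeight (m - 1) * z (m - 1))
        + B m * (expWeight m * z m) = _
    rw [← h2]
    linear_combination (-expWeight m) * h1
  · have h : evalZero (-(weightedTridiagonal ε B ∘ₗ weightedTridiagonal ε A) deltaZero) =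
        -(2 * ε ^ 2 + b 0 * a 0) := by
      change -(weightedTridiagonal ε B (weightedTridiagonal ε A deltaZero) 0) = _
      simp only [weightedTridiagonal_apply, deltaZero_apply]
      simp [expWeight, A, B]
      ring
    change |Λ - evalZero (-(weightedTridiagonal ε B ∘ₗ weightedTridiagonal ε A) deltaZero)| ≤ _
      at hΛ
    rw [h] at hΛ
    calc |Λ + 2 * ε ^ 2 + b 0 * a 0| = |Λ - -(2 * ε ^ 2 + b 0 * a 0)| := by ring_nf
      _ ≤ 6 * (80 * ε) ^ 2 := hΛ
      _ = 38400 * ε ^ 2 := by ring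

theorem abs_le_sqrt_tsum_sq {f : ℤ → ℝ} (hf : Summable fun m => f m ^ 2) (m : ℤ) :
    |f m| ≤ Real.sqrt (∑' k, f k ^ 2) :=
  Real.abs_le_sqrt (hf.le_tsum m fun _ _ => sq_nonneg _)

theorem summable_sq_sub_ite {ψ : ℤ → ℝ} (hψ : Memℓp ψ 2) :
    Summable fun m : ℤ => (ψ m - if m = 0 then 1 else 0) ^ 2 := by
  have h1 : Summable fun m => ψ m ^ 2 := by
    simpa using (memℓp_gen_iff (by norm_num)).1 hψ
  refine h1.congr_cofinite ?_
  filter_upwards [(Set.finite_singleton (0 : ℤ)).compl_mem_cofinite] with m hm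
  rw [if_neg (by simpa using hm), sub_zero]


/-- Theorem 1 (asymptotic expansion of the unstable eigenvalue at the Γ point).
Near the anti-continuum limit, for the fundamental line soliton `ψ ≈ e₀` (with
`μ = 1`), the Γ-point linear-stability problem has an eigenvalue `λ` with
`λ² = 8ε sin²(p/2) + O(ε²)`, uniformly in `p ∈ [-π,π]`. -/
theorem unstable_eigenvalue_expansion_Gamma :
    ∃ ε₀ C : ℝ, 0 < ε₀ ∧ 0 < C ∧
      ∀ ε : ℝ, 0 < ε → ε < ε₀ →
      ∀ p : ℝ, p ∈ Set.Icc (-Real.pi) Real.pi →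
      ∀ ψ : ℤ → ℝ, Memℓp ψ 2 → (∀ m : ℤ, 0 < ψ m) →
      (∀ m : ℤ, -ψ m + ε * (ψ (m + 1) + ψ (m - 1) - 2 * ψ m) + (ψ m) ^ 3 = 0) →
      Real.sqrt (∑' m : ℤ, (ψ m - if m = 0 then 1 else 0) ^ 2) ≤ 2 * ε →
      ∃ (lam : ℂ) (U W : ℤ → ℂ), Memℓp U 2 ∧ Memℓp W 2 ∧ ¬(U = 0 ∧ W = 0) ∧
        (∀ m : ℤ, -(ε : ℂ) * (U (m + 1) + U (m - 1)
            + 2 * (Real.cos p : ℂ) * U m - 4 * U m)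
          + U m - 3 * ((ψ m : ℝ) : ℂ) ^ 2 * U m = (-lam) * W m) ∧
        (∀ m : ℤ, -(ε : ℂ) * (W (m + 1) + W (m - 1)
            + 2 * (Real.cos p : ℂ) * W m - 4 * W m)
          + W m - ((ψ m : ℝ) : ℂ) ^ 2 * W m = lam * U m) ∧
        ‖lam ^ 2 - ((8 * ε * Real.sin (p / 2) ^ 2 : ℝ) : ℂ)‖ ≤ C * ε ^ 2 := by
  refine ⟨1 / 1000, 40000, by norm_num, by norm_num, ?_⟩
  intro ε hε hε' p _ ψ hψ _ heq hsqrt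
  have hclose : ∀ m, |ψ m - if m = 0 then 1 else 0| ≤ 2 * ε := fun m =>
    (abs_le_sqrt_tsum_sq (summable_sq_sub_ite hψ) m).trans hsqrt
  have hcos := Real.neg_one_le_cos p
  have hcos' := Real.cos_le_one p
  have hψ0 := abs_le.1 (hclose 0)
  have hψ1 := abs_le.1 (hclose 1)
  have hψ2 := abs_le.1 (hclose (-1))
  norm_num at hψ0 hψ1 hψ2
  have hsq : ∀ m, |ψ m ^ 2 - if m = 0 then 1 else 0| ≤ 5 * ε := by
    intro m
    have h := abs_le.1 (hclose m)
    rw [abs_le]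
    split_ifs at h ⊢ <;> constructor <;> nlinarith
  set a : ℤ → ℝ := fun m => 4 * ε - 2 * ε * Real.cos p + 1 - ψ m ^ 2 with ha
  set b : ℤ → ℝ := fun m => 4 * ε - 2 * ε * Real.cos p + 1 - 3 * ψ m ^ 2 with hb
  have hab : ∀ m, |a m - if m = 0 then 0 else 1| ≤ 11 * ε := by
    intro m
    have h := abs_le.1 (hsq m)
    rw [abs_le, ha]
    split_ifs at h ⊢ <;> constructor <;> nlinarith
  have hbb : ∀ m, |b m - if m = 0 then -2 else 1| ≤ 21 * ε := by
    intro m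
    have h := abs_le.1 (hsq m)
    rw [abs_le, hb]
    split_ifs at h ⊢ <;> constructor <;> nlinarith
  obtain ⟨W, Z, Λ, c, hW0, hWc, hZc, hWZ, hZW, hΛ⟩ :=
    exists_eigenvector_neg_comp hε.le hε'.le a b hab hbb
  have hexp : |Λ - 8 * ε * Real.sin (p / 2) ^ 2| ≤ 40000 * ε ^ 2 := by
    have hsin : 2 * ε * (1 - Real.cos p) = 4 * ε * Real.sin (p / 2) ^ 2 := by
      rw [Real.sin_sq_eq_half_sub, mul_div_cancel₀ p two_ne_zero]
      ring
    have h0 := heq 0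
    norm_num at h0
    have hq : |1 + 2 * ε - ψ 0 ^ 2| ≤ 5 * ε ^ 2 := by
      have h1 : ψ 0 * (1 + 2 * ε - ψ 0 ^ 2) = ε * (ψ 1 + ψ (-1)) := by linear_combination -h0
      have h2 : |ε * (ψ 1 + ψ (-1))| ≤ ε * (4 * ε) := by
        rw [abs_mul, abs_of_pos hε]
        gcongr
        rw [abs_le]
        constructor <;> linarith
      rw [← h1, abs_mul, abs_of_nonneg (by linarith : 0 ≤ ψ 0)] at h2
      nlinarith [abs_nonneg (1 + 2 * ε - ψ 0 ^ 2)]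
    have ha0 : |a 0| ≤ 11 * ε := by simpa using hab 0
    have hb0 : |b 0 + 2| ≤ 21 * ε := by simpa using hbb 0
    have hprod : |(b 0 + 2) * a 0| ≤ 21 * ε * (11 * ε) := by
      rw [abs_mul]
      exact mul_le_mul hb0 ha0 (abs_nonneg _) (by positivity)
    have ha0' : a 0 = 4 * ε * Real.sin (p / 2) ^ 2 + (1 + 2 * ε - ψ 0 ^ 2) := by
      rw [← hsin, ha]
      ring
    rw [abs_le] at hq hprod hΛ ⊢
    constructor <;> nlinarith
  obtain ⟨lam, hlam⟩ := IsAlgClosed.exists_pow_nat_eq (Λ : ℂ) (n := 2) two_pos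
  have hWmem : Memℓp (fun m => (W m : ℂ)) 2 :=
    memℓp_two_of_norm_le_expWeight (c := c) fun m => by simpa using hWc m
  have hZmem : Memℓp (fun m => (Z m : ℂ)) 2 :=
    memℓp_two_of_norm_le_expWeight (c := c) fun m => by simpa using hZc m
  have hWZ' : ∀ m, -(ε : ℂ) * (W (m + 1) + W (m - 1) + 2 * (Real.cos p : ℂ) * W m - 4 * W m)
      + W m - ((ψ m : ℝ) : ℂ) ^ 2 * W m = Z m := by
    intro m
    have h := congrArg (fun r : ℝ => (r : ℂ)) (hWZ m)
    simp only [ha] at h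
    push_cast at h ⊢
    linear_combination h
  have hZW' : ∀ m, -(ε : ℂ) * (Z (m + 1) + Z (m - 1) + 2 * (Real.cos p : ℂ) * Z m - 4 * Z m)
      + Z m - 3 * ((ψ m : ℝ) : ℂ) ^ 2 * Z m = -lam ^ 2 * W m := by
    intro m
    have h := congrArg (fun r : ℝ => (r : ℂ)) (hZW m)
    simp only [hb] at h
    rw [hlam]
    push_cast at h ⊢
    linear_combination h
  have hest : ‖lam ^ 2 - ((8 * ε * Real.sin (p / 2) ^ 2 : ℝ) : ℂ)‖ ≤ 40000 * ε ^ 2 := by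
    rw [hlam, ← Complex.ofReal_sub, Complex.norm_real]
    exact hexp
  have hWne : (fun m => (W m : ℂ)) ≠ 0 := fun h => by simpa [hW0] using congrFun h 0
  by_cases hlam0 : lam = 0
  · by_cases hZ0 : (fun m => (Z m : ℂ)) = 0
    · refine ⟨lam, 0, fun m => W m, zero_memℓp, hWmem, fun h => hWne h.2, fun m => ?_, fun m => ?_,
        hest⟩
      · simp [hlam0]
      · simpa [congrFun hZ0 m] using hWZ' m
    · refine ⟨lam, fun m => Z m, 0, hZmem, zero_memℓp, fun h => hZ0 h.1, fun m => ?_, fun m => ?_,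
        hest⟩
      · simpa [hlam0] using hZW' m
      · simp [hlam0]
  · refine ⟨lam, fun m => lam⁻¹ * Z m, fun m => W m, hZmem.const_mul lam⁻¹, hWmem,
      fun h => hWne h.2, fun m => ?_, fun m => ?_, hest⟩
    · have h : lam⁻¹ * (-lam ^ 2 * W m) = -lam * W m := by field_simp
      rw [← h, ← hZW' m]
      ring
    · rw [mul_inv_cancel_left₀ hlam0]
      exact hWZ' m
end

section
/- (Theorem 2, transverse stability at the X point.) Let e₀ ∈ l²(ℤ, ℝ) be the Kronecker delta sequence at site 0. There exist ε₀ > 0 and δ₀ > 0 such that for every ε ∈ (0, ε₀), every solution ψ ∈ l²(ℤ, ℝ) of the stationary 1D dNLS equation with μ = 1 satisfying ψ_m > 0 for all m and ‖ψ − e₀‖_{l²} ≤ δ₀, and every p ∈ [−π, π], the X-point linear-stability problem admits no unstable eigenvalues: there is no λ ∈ ℂ with Re λ ≠ 0 for which a nonzero pair (U, W) ∈ l²(ℤ, ℂ)² satisfies L₊(p)U = −λW and L₋(p)W = λU. Hence the fundamental line soliton bifurcating from the X point is transversely stable for small ε. -/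
open scoped InnerProductSpace ComplexConjugate

section Abstract
variable {H : Type*} [NormedAddCommGroup H] [InnerProductSpace ℂ H]

set_option maxHeartbeats 1000000 in
/-- Let `P`, `M` be symmetric operators that are both bounded below by `1 / 2` on the orthogonal
complement of a vector `v`, where `v` is an eigenvector of `M` with a small nonpositive eigenvalue
and the form of `P` is nonpositive at `v`. Then the Hamiltonian system `P U = -l W`, `M W = l U`
has no nontrivial solution with `re l ≠ 0`. -/
theorem eq_zero_of_common_negative_direction (P M : H →ₗ[ℂ] H) (hP : P.IsSymmetric)
    (hM : M.IsSymmetric) (v : H) (k : ℝ) (hk0 : 0 ≤ k) (hk1 : k ≤ 1 / 2500)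
    (hv0 : 9 / 10 ≤ ‖v‖) (hv1 : ‖v‖ ≤ 11 / 10) (hMv : M v = (-(k : ℂ)) • v)
    (hPv : ‖P v‖ ≤ 3) (hPneg : (⟪v, P v⟫_ℂ).re ≤ 0)
    (hMpos : ∀ w : H, ⟪v, w⟫_ℂ = 0 → ‖w‖ ^ 2 / 2 ≤ (⟪w, M w⟫_ℂ).re)
    (hPpos : ∀ w : H, ⟪v, w⟫_ℂ = 0 → ‖w‖ ^ 2 / 2 ≤ (⟪w, P w⟫_ℂ).re)
    (l : ℂ) (hl : l.re ≠ 0) (U W : H) (hU : P U = (-l) • W) (hW : M W = l • U) :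
    U = 0 ∧ W = 0 := by
  have hl0 : l ≠ 0 := by rintro rfl; simp at hl
  have hvpos : 0 < ‖v‖ := by linarith
  have hNC : (⟪v, v⟫_ℂ) = ((‖v‖ ^ 2 : ℝ) : ℂ) := by
    rw [inner_self_eq_norm_sq_to_K]; push_cast; rfl
  have hN0 : ((‖v‖ ^ 2 : ℝ) : ℂ) ≠ 0 := by
    exact_mod_cast (pow_pos hvpos 2).ne'
  have hUW : U = 0 → U = 0 ∧ W = 0 := by
    intro h
    refine ⟨h, ?_⟩
    have : (-l) • W = 0 := by rw [← hU, h, map_zero]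
    exact (smul_eq_zero.1 this).resolve_left (neg_ne_zero.2 hl0)
  set N : ℝ := ‖v‖ ^ 2 with hN
  obtain ⟨a, u, hUa, hu⟩ : ∃ a : ℂ, ∃ u : H, U = a • v + u ∧ ⟪v, u⟫_ℂ = 0 := by
    refine ⟨⟪v, U⟫_ℂ / N, U - (⟪v, U⟫_ℂ / N) • v, by abel, ?_⟩
    rw [inner_sub_right, inner_smul_right, hNC]; field_simp; simp
  obtain ⟨b, w, hWb, hw⟩ : ∃ b : ℂ, ∃ w : H, W = b • v + w ∧ ⟪v, w⟫_ℂ = 0 := by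
    refine ⟨⟪v, W⟫_ℂ / N, W - (⟪v, W⟫_ℂ / N) • v, by abel, ?_⟩
    rw [inner_sub_right, inner_smul_right, hNC]; field_simp; simp
  have hu' : ⟪u, v⟫_ℂ = 0 := inner_eq_zero_symm.1 hu
  have hw' : ⟪w, v⟫_ℂ = 0 := inner_eq_zero_symm.1 hw
  have hab : -(k : ℂ) * b = l * a := by
    have h : ⟪v, M W⟫_ℂ = ⟪M v, W⟫_ℂ := (hM v W).symm
    rw [hW, hMv, inner_smul_right, inner_smul_left, hUa, hWb, inner_add_right, inner_add_right,
      inner_smul_right, inner_smul_right, hu, hw, hNC] at h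
    simp only [map_neg, Complex.conj_ofReal] at h
    apply mul_right_cancel₀ hN0
    linear_combination -h
  have hMw : M w = l • u := by
    have h := hW
    rw [hWb, hUa, map_add, map_smul, hMv] at h
    have e : (b • (-(k : ℂ)) • v : H) = l • a • v := by
      rw [smul_smul, smul_smul, ← hab, mul_comm]
    rw [e, smul_add] at h
    exact add_left_cancel h
  have hPe : a • P v + P u = (-l) • W := by rw [← hU, hUa, map_add, map_smul]
  have hmw := hMpos w hw
  have hpu := hPpos u hu
  have hqw : ⟪w, M w⟫_ℂ = l * ⟪w, u⟫_ℂ := by rw [hMw, inner_smul_right]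
  have hsym : ⟪v, P u⟫_ℂ = conj ⟪u, P v⟫_ℂ := by
    rw [inner_conj_symm, hP]
  by_cases him : l.im = 0
  · obtain ⟨r, rfl⟩ : ∃ r : ℝ, l = r := ⟨l.re, by apply Complex.ext <;> simp [him]⟩
    have h2 : a * ⟪u, P v⟫_ℂ + ⟪u, P u⟫_ℂ = -r * ⟪u, w⟫_ℂ := by
      have := congrArg (fun x => ⟪u, x⟫_ℂ) hPe
      simpa only [inner_add_right, inner_smul_right, hWb, hu', mul_zero, zero_add] using this
    have h3 : a * ⟪v, P v⟫_ℂ + conj ⟪u, P v⟫_ℂ = -r * (b * N) := by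
      have := congrArg (fun x => ⟪v, x⟫_ℂ) hPe
      simp only [inner_add_right, inner_smul_right, hWb, hw, hNC, hsym] at this
      simpa using this
    have h3' : (a * conj a) * ⟪v, P v⟫_ℂ + conj (a * ⟪u, P v⟫_ℂ) = (k * N : ℝ) * (b * conj b) := by
      have hc := congrArg conj hab
      simp only [map_mul, map_neg, Complex.conj_ofReal] at hc
      rw [map_mul]; push_cast
      linear_combination conj a * h3 + b * N * hc
    rw [Complex.mul_conj, Complex.mul_conj] at h3'
    have r3 := congrArg Complex.re h3'
    have r2 := congrArg Complex.re h2
    have r1 := congrArg Complex.re hqw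
    rw [← inner_conj_symm w u] at r1
    simp only [Complex.add_re, Complex.conj_re, Complex.re_ofReal_mul, ← Complex.ofReal_neg,
      Complex.ofReal_re] at r1 r2 r3
    have hna := Complex.normSq_nonneg a
    have hnb := Complex.normSq_nonneg b
    have hkN : 0 ≤ k * N := by positivity
    have t1 : 0 ≤ k * N * Complex.normSq b := mul_nonneg hkN hnb
    have t2 := mul_nonneg hna (neg_nonneg.2 hPneg)
    have hu2 : ‖u‖ ^ 2 = 0 := by nlinarith [sq_nonneg ‖u‖, sq_nonneg ‖w‖]
    have hb2 : k * N * Complex.normSq b = 0 := by nlinarith [sq_nonneg ‖u‖, sq_nonneg ‖w‖]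
    have hu0 : u = 0 := by simpa using hu2
    have hkb : (k : ℂ) * b = 0 := by
      rcases mul_eq_zero.1 hb2 with h | h
      · rcases mul_eq_zero.1 h with h | h
        · simp [h]
        · exact absurd (by exact_mod_cast h) hN0
      · simp [Complex.normSq_eq_zero.1 h]
    have ha0 : a = 0 := by
      have : (r : ℂ) * a = 0 := by rw [← hab, neg_mul, hkb, neg_zero]
      exact (mul_eq_zero.1 this).resolve_left hl0
    exact hUW (by rw [hUa, hu0, ha0]; simp)
  · have hA : (⟪W, M W⟫_ℂ).im = 0 := by
      have := hM.im_inner_self_apply W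
      simpa using this
    have hB : (⟪U, P U⟫_ℂ).im = 0 := by
      have := hP.im_inner_self_apply U
      simpa using this
    have hz : ⟪W, U⟫_ℂ = 0 := by
      rw [hW, inner_smul_right] at hA
      rw [hU, inner_smul_right, ← inner_conj_symm] at hB
      simp only [Complex.mul_im, Complex.conj_re, Complex.conj_im, Complex.neg_re,
        Complex.neg_im] at hA hB
      apply Complex.ext
      · have : l.im * (⟪W, U⟫_ℂ).re = 0 := by linarith
        simpa using (mul_eq_zero.1 this).resolve_left him
      · have : l.re * (⟪W, U⟫_ℂ).im = 0 := by linarith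
        simpa using (mul_eq_zero.1 this).resolve_left hl
    have hPU : ⟪U, P U⟫_ℂ = 0 := by
      rw [hU, inner_smul_right, ← inner_conj_symm, hz]; simp
    have hwu : ⟪w, u⟫_ℂ = -(conj b * a * N) := by
      rw [hWb, hUa] at hz
      simp only [inner_add_left, inner_add_right, inner_smul_left, inner_smul_right, hu, hw', hNC]
        at hz
      linear_combination hz
    have hq : (k : ℂ) * ⟪w, M w⟫_ℂ = ((‖l‖ ^ 2 * ‖a‖ ^ 2 * N : ℝ) : ℂ) := by
      have hc := congrArg conj hab
      simp only [map_mul, map_neg, Complex.conj_ofReal] at hc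
      rw [hqw, hwu]; push_cast
      rw [← Complex.mul_conj', ← Complex.mul_conj']
      linear_combination l * a * N * hc
    have hq' : k * (⟪w, M w⟫_ℂ).re = ‖l‖ ^ 2 * ‖a‖ ^ 2 * N := by
      have := congrArg Complex.re hq
      rwa [Complex.re_ofReal_mul, Complex.ofReal_re] at this
    have hle : (⟪w, M w⟫_ℂ).re ≤ ‖l‖ * (‖w‖ * ‖u‖) := by
      calc (⟪w, M w⟫_ℂ).re ≤ ‖⟪w, M w⟫_ℂ‖ := Complex.re_le_norm _
        _ = ‖l‖ * ‖⟪w, u⟫_ℂ‖ := by rw [hqw, norm_mul]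
        _ ≤ _ := by gcongr; exact norm_inner_le_norm w u
    have hlpos : 0 < ‖l‖ := norm_pos_iff.2 hl0
    have hwle : ‖w‖ ≤ 2 * (‖l‖ * ‖u‖) := by
      by_contra! h
      have : 0 ≤ ‖l‖ * ‖u‖ := by positivity
      nlinarith
    have hqle : (⟪w, M w⟫_ℂ).re ≤ ‖l‖ ^ 2 * (2 * ‖u‖ ^ 2) := by
      calc _ ≤ ‖l‖ * (‖w‖ * ‖u‖) := hle
        _ ≤ ‖l‖ * (2 * (‖l‖ * ‖u‖) * ‖u‖) := by gcongr
        _ = _ := by ring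
    have haN : ‖a‖ ^ 2 * N ≤ k * (2 * ‖u‖ ^ 2) := by
      have := mul_le_mul_of_nonneg_left hqle hk0
      rw [hq'] at this
      have l2 : 0 < ‖l‖ ^ 2 := by positivity
      exact le_of_mul_le_mul_left (by linarith) l2
    have ha : ‖a‖ ≤ 1 / 25 * ‖u‖ := by
      apply le_of_sq_le_sq _ (by positivity)
      have hN' : 81 / 100 ≤ N := by rw [hN]; nlinarith
      have := mul_le_mul_of_nonneg_left hN' (sq_nonneg ‖a‖)
      have := mul_le_mul_of_nonneg_right hk1 (by positivity : 0 ≤ 2 * ‖u‖ ^ 2)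
      nlinarith [sq_nonneg ‖u‖]
    have hexp : (‖a‖ ^ 2 : ℝ) * (⟪v, P v⟫_ℂ).re + 2 * (a * ⟪u, P v⟫_ℂ).re + (⟪u, P u⟫_ℂ).re
        = 0 := by
      have := congrArg Complex.re hPU
      rw [hUa] at this
      simp only [map_add, map_smul, inner_add_left, inner_add_right, inner_smul_left,
        inner_smul_right, hsym] at this
      rw [mul_add a, ← mul_assoc, Complex.mul_conj', ← map_mul] at this
      simp only [Complex.add_re, Complex.conj_re, ← Complex.ofReal_pow, Complex.re_ofReal_mul,
        Complex.zero_re] at this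
      linarith
    have h1 : |(⟪v, P v⟫_ℂ).re| ≤ 33 / 10 := by
      calc _ ≤ ‖⟪v, P v⟫_ℂ‖ := Complex.abs_re_le_norm _
        _ ≤ ‖v‖ * ‖P v‖ := norm_inner_le_norm _ _
        _ ≤ 11 / 10 * 3 := by gcongr
        _ = _ := by norm_num
    have h2 : |(a * ⟪u, P v⟫_ℂ).re| ≤ 1 / 25 * ‖u‖ * (‖u‖ * 3) := by
      calc _ ≤ ‖a * ⟪u, P v⟫_ℂ‖ := Complex.abs_re_le_norm _
        _ = ‖a‖ * ‖⟪u, P v⟫_ℂ‖ := norm_mul _ _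
        _ ≤ ‖a‖ * (‖u‖ * ‖P v‖) := by gcongr; exact norm_inner_le_norm _ _
        _ ≤ _ := by gcongr
    have h3 : ‖a‖ ^ 2 ≤ (1 / 25 * ‖u‖) ^ 2 := by gcongr
    have h4 := mul_le_mul_of_nonneg_left (abs_le.1 h1).1 (sq_nonneg ‖a‖)
    have hu2 : ‖u‖ ^ 2 = 0 := by
      have h5 := (abs_le.1 h2).1
      have h6 := sq_nonneg ‖u‖
      ring_nf at h3 h4 h5 hexp hpu ⊢
      linarith
    have hu0 : u = 0 := by simpa using hu2
    have ha0 : a = 0 := by simpa [hu0] using ha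
    exact hUW (by rw [hUa, hu0, ha0]; simp)

end Abstract

section Sequences

theorem Memℓp.comp_equiv {f : ℤ → ℂ} (hf : Memℓp f 2) (e : ℤ ≃ ℤ) :
    Memℓp (fun m => f (e m)) 2 := by
  refine memℓp_gen ?_
  exact e.summable_iff.2 (hf.summable (by norm_num))

/-- Reindexing of a square-summable sequence along a permutation, as a linear map. -/
noncomputable def reindex (e : ℤ ≃ ℤ) : lp (fun _ : ℤ => ℂ) 2 →ₗ[ℂ] lp (fun _ : ℤ => ℂ) 2 where
  toFun x := ⟨fun m => x (e m), (lp.memℓp x).comp_equiv e⟩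
  map_add' _ _ := rfl
  map_smul' _ _ := rfl

@[simp] theorem reindex_apply (e : ℤ ≃ ℤ) (x : lp (fun _ : ℤ => ℂ) 2) (m : ℤ) :
    reindex e x m = x (e m) := rfl

theorem inner_reindex (e : ℤ ≃ ℤ) (x y : lp (fun _ : ℤ => ℂ) 2) :
    ⟪reindex e x, y⟫_ℂ = ⟪x, reindex e.symm y⟫_ℂ := by
  rw [lp.inner_eq_tsum, lp.inner_eq_tsum, ← e.tsum_eq (fun m => ⟪x m, reindex e.symm y m⟫_ℂ)]
  simp

theorem norm_reindex (e : ℤ ≃ ℤ) (x : lp (fun _ : ℤ => ℂ) 2) : ‖reindex e x‖ = ‖x‖ := by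
  have h : ⟪reindex e x, reindex e x⟫_ℂ = ⟪x, x⟫_ℂ := by
    rw [inner_reindex]; congr 1; ext m; simp
  rw [inner_self_eq_norm_sq_to_K, inner_self_eq_norm_sq_to_K] at h
  have h' : ‖reindex e x‖ ^ 2 = ‖x‖ ^ 2 := by exact_mod_cast h
  exact (sq_eq_sq₀ (norm_nonneg _) (norm_nonneg _)).1 h'

/-- Multiplication of a square-summable sequence by a bounded real sequence. -/
noncomputable def multiplier (f : ℤ → ℝ) (C : ℝ) (hf : ∀ m, |f m| ≤ C) :
    lp (fun _ : ℤ => ℂ) 2 →ₗ[ℂ] lp (fun _ : ℤ => ℂ) 2 where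
  toFun x := ⟨fun m => (f m : ℂ) * x m, by
    refine ((lp.memℓp x).const_smul (C : ℂ)).mono' fun m => ?_
    have hC : 0 ≤ C := (abs_nonneg _).trans (hf m)
    simp only [norm_mul, Complex.norm_real, Real.norm_eq_abs, Pi.smul_apply, smul_eq_mul,
      abs_of_nonneg hC]
    gcongr
    exact hf m⟩
  map_add' x y := by ext m; exact mul_add _ _ _
  map_smul' c x := by ext m; exact mul_left_comm _ _ _

variable {f : ℤ → ℝ} {C : ℝ} (hf : ∀ m, |f m| ≤ C)

@[simp] theorem multiplier_apply (x : lp (fun _ : ℤ => ℂ) 2) (m : ℤ) :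
    multiplier f C hf x m = f m * x m := rfl

theorem multiplier_isSymmetric : (multiplier f C hf).IsSymmetric := by
  intro x y
  rw [lp.inner_eq_tsum, lp.inner_eq_tsum]
  refine tsum_congr fun m => ?_
  simp
  ring

theorem hasSum_norm_sq (x : lp (fun _ : ℤ => ℂ) 2) : HasSum (fun m => ‖x m‖ ^ 2) (‖x‖ ^ 2) := by
  simpa using lp.hasSum_norm (by norm_num) x

theorem hasSum_multiplier (x : lp (fun _ : ℤ => ℂ) 2) :
    HasSum (fun m => f m * ‖x m‖ ^ 2) (⟪x, multiplier f C hf x⟫_ℂ).re := by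
  convert! Complex.hasSum_re (lp.hasSum_inner x (multiplier f C hf x)) using 2 with m
  simp only [multiplier_apply, RCLike.inner_apply, mul_assoc, Complex.mul_conj,
    Complex.re_ofReal_mul, Complex.ofReal_re, Complex.normSq_eq_norm_sq]

theorem norm_multiplier_le (x : lp (fun _ : ℤ => ℂ) 2) : ‖multiplier f C hf x‖ ≤ C * ‖x‖ := by
  have hC : 0 ≤ C := (abs_nonneg _).trans (hf 0)
  refine le_of_sq_le_sq ?_ (by positivity)
  rw [mul_pow]
  refine hasSum_le (fun m => ?_) (hasSum_norm_sq (multiplier f C hf x))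
    ((hasSum_norm_sq x).mul_left (C ^ 2))
  rw [multiplier_apply, norm_mul, Complex.norm_real, Real.norm_eq_abs, mul_pow]
  gcongr
  exact hf m

/-- The operator `-ε(x_{m+1} + x_{m-1} - 2cx_m) + x_m - f_m x_m`. -/
noncomputable def discreteSchrodinger (ε c : ℝ) (f : ℤ → ℝ) (C : ℝ) (hf : ∀ m, |f m| ≤ C) :
    lp (fun _ : ℤ => ℂ) 2 →ₗ[ℂ] lp (fun _ : ℤ => ℂ) 2 :=
  (-(ε : ℂ)) • (reindex (Equiv.addRight 1) + reindex (Equiv.addRight 1).symm)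
    + ((1 + 2 * ε * c : ℝ) : ℂ) • LinearMap.id - multiplier f C hf

theorem discreteSchrodinger_apply (ε c : ℝ) (x : lp (fun _ : ℤ => ℂ) 2) (m : ℤ) :
    discreteSchrodinger ε c f C hf x m =
      -(ε : ℂ) * (x (m + 1) + x (m - 1) - 2 * c * x m) + x m - f m * x m := by
  have : discreteSchrodinger ε c f C hf x m = -(ε : ℂ) * (x (m + 1) + x (m + -1))
    + ((1 + 2 * ε * c : ℝ) : ℂ) * x m - f m * x m := rfl
  rw [this]; push_cast; rw [← sub_eq_add_neg]; ring

theorem discreteSchrodinger_isSymmetric (ε c : ℝ) :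
    (discreteSchrodinger ε c f C hf).IsSymmetric := by
  intro x y
  have := multiplier_isSymmetric hf x y
  simp only [discreteSchrodinger, LinearMap.sub_apply, LinearMap.add_apply, LinearMap.smul_apply,
    LinearMap.id_apply, inner_sub_left, inner_sub_right, inner_add_left, inner_add_right,
    inner_smul_left, inner_smul_right, inner_reindex, this, Equiv.symm_symm, map_neg,
    Complex.conj_ofReal]
  ring

theorem le_inner_discreteSchrodinger (ε c : ℝ) (hε : 0 ≤ ε) (hc : -1 ≤ c)
    (x : lp (fun _ : ℤ => ℂ) 2) :
    (1 - 4 * ε) * ‖x‖ ^ 2 - (⟪x, multiplier f C hf x⟫_ℂ).re ≤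
      (⟪x, discreteSchrodinger ε c f C hf x⟫_ℂ).re := by
  have key (e : ℤ ≃ ℤ) : (⟪x, reindex e x⟫_ℂ).re ≤ ‖x‖ ^ 2 :=
    calc _ ≤ ‖⟪x, reindex e x⟫_ℂ‖ := Complex.re_le_norm _
      _ ≤ ‖x‖ * ‖reindex e x‖ := norm_inner_le_norm _ _
      _ = _ := by rw [norm_reindex, sq]
  have h1 := key (Equiv.addRight 1)
  have h2 := key (Equiv.addRight 1).symm
  have h3 : (⟪x, x⟫_ℂ).re = ‖x‖ ^ 2 := inner_self_eq_norm_sq (𝕜 := ℂ) x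
  simp only [discreteSchrodinger, LinearMap.sub_apply, LinearMap.add_apply, LinearMap.smul_apply,
    LinearMap.id_apply, inner_sub_right, inner_add_right, inner_smul_right, Complex.sub_re,
    Complex.add_re, ← Complex.ofReal_neg, Complex.re_ofReal_mul, h3]
  have h4 := mul_le_mul_of_nonneg_left (add_le_add h1 h2) hε
  have h5 : 0 ≤ ε * (c + 1) * ‖x‖ ^ 2 := by
    have : 0 ≤ c + 1 := by linarith
    positivity
  nlinarith

/-- The multiplier form is small on sequences with a small value at the origin. -/
theorem inner_multiplier_le (A B d : ℝ) (hB : 0 ≤ B) (h0 : f 0 ≤ A + B)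
    (hne : ∀ m, m ≠ 0 → f m ≤ A)
    (x : lp (fun _ : ℤ => ℂ) 2) (hx : ‖x 0‖ ≤ d * ‖x‖) :
    (⟪x, multiplier f C hf x⟫_ℂ).re ≤ (A + B * d ^ 2) * ‖x‖ ^ 2 := by
  have hs := ((hasSum_norm_sq x).mul_left A).add (hasSum_ite_eq (0 : ℤ) (B * ‖x 0‖ ^ 2))
  have hle := hasSum_le (fun m => ?_) (hasSum_multiplier hf x) hs
  · have : ‖x 0‖ ^ 2 ≤ (d * ‖x‖) ^ 2 := by gcongr
    nlinarith
  · rcases eq_or_ne m 0 with rfl | hm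
    · simp only [if_true]
      nlinarith [sq_nonneg ‖x 0‖]
    · simp only [hm, if_false, add_zero]
      exact mul_le_mul_of_nonneg_right (hne m hm) (sq_nonneg _)

end Sequences

/-- Theorem 2 (transverse stability at the X point). For small `ε > 0` and the
fundamental line soliton `ψ ≈ e₀` (with `μ = 1`), the X-point linear-stability
problem `L₊(p)U = -λW`, `L₋(p)W = λU` admits no eigenvalue `λ` with `Re λ ≠ 0`,
for any transverse wavenumber `p ∈ [-π,π]`. -/
theorem transverse_stability_X_point :
    ∃ ε₀ δ₀ : ℝ, 0 < ε₀ ∧ 0 < δ₀ ∧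
      ∀ ε : ℝ, 0 < ε → ε < ε₀ →
      ∀ ψ : ℤ → ℝ, Memℓp ψ 2 → (∀ m : ℤ, 0 < ψ m) →
      (∀ m : ℤ, -ψ m + ε * (ψ (m + 1) + ψ (m - 1) - 2 * ψ m) + (ψ m) ^ 3 = 0) →
      Real.sqrt (∑' m : ℤ, (ψ m - if m = 0 then 1 else 0) ^ 2) ≤ δ₀ →
      ∀ p : ℝ, p ∈ Set.Icc (-Real.pi) Real.pi →
      ¬ ∃ lam : ℂ, lam.re ≠ 0 ∧
        ∃ U W : ℤ → ℂ, Memℓp U 2 ∧ Memℓp W 2 ∧ ¬(U = 0 ∧ W = 0) ∧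
          (∀ m : ℤ, -(ε : ℂ) * (U (m + 1) + U (m - 1) - 2 * (Real.cos p : ℂ) * U m)
            + U m - 3 * ((ψ m : ℝ) : ℂ) ^ 2 * U m = (-lam) * W m) ∧
          (∀ m : ℤ, -(ε : ℂ) * (W (m + 1) + W (m - 1) - 2 * (Real.cos p : ℂ) * W m)
            + W m - ((ψ m : ℝ) : ℂ) ^ 2 * W m = lam * U m) := by
  refine ⟨1 / 10000, 1 / 10, by norm_num, by norm_num, ?_⟩
  rintro ε hε hε1 ψ hψ - heq hδ p - ⟨lam, hlam, U, W, hU, hW, hne, hLU, hLW⟩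
  apply hne
  have hψc : Memℓp (fun m => (ψ m : ℂ)) 2 := hψ.mono' fun m => by simp
  let v : lp (fun _ : ℤ => ℂ) 2 := ⟨fun m => (ψ m : ℂ), hψc⟩
  have hvm (m : ℤ) : v m = ψ m := rfl
  let e : lp (fun _ : ℤ => ℂ) 2 := lp.single 2 0 1
  have hem (m : ℤ) : e m = ((if m = 0 then 1 else 0 : ℝ) : ℂ) := by
    simp only [e, lp.coeFn_single, Pi.single_apply]; split_ifs <;> simp
  have hd : ‖v - e‖ ≤ 1 / 10 := by
    refine le_trans (Real.le_sqrt_of_sq_le (le_of_eq ?_)) hδ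
    rw [← (hasSum_norm_sq (v - e)).tsum_eq]
    refine tsum_congr fun m => ?_
    rw [lp.coeFn_sub, Pi.sub_apply, hvm, hem, ← Complex.ofReal_sub, Complex.norm_real,
      Real.norm_eq_abs, sq_abs]
  have hdm (m : ℤ) : |ψ m - if m = 0 then 1 else 0| ≤ 1 / 10 := by
    have := (lp.norm_apply_le_norm (by norm_num) (v - e) m).trans hd
    rwa [lp.coeFn_sub, Pi.sub_apply, hvm, hem, ← Complex.ofReal_sub, Complex.norm_real,
      Real.norm_eq_abs] at this
  have he : ‖e‖ = 1 := by simp [e, lp.norm_single]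
  have hv1 : ‖v‖ ≤ 11 / 10 := by
    have := norm_le_norm_add_norm_sub e v
    rw [norm_sub_rev] at this
    linarith
  have hv0 : 9 / 10 ≤ ‖v‖ := by
    have := norm_sub_norm_le e v
    rw [norm_sub_rev] at this
    linarith
  have hsq0 : ψ 0 ^ 2 ≤ 121 / 100 := by
    have := abs_le.1 (hdm 0)
    simp only [if_true] at this
    nlinarith
  have hsqne (m : ℤ) (hm : m ≠ 0) : ψ m ^ 2 ≤ 1 / 100 := by
    have := abs_le.1 (hdm m)
    simp only [hm, if_false, sub_zero] at this
    nlinarith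
  have hf1 (m : ℤ) : |ψ m ^ 2| ≤ 121 / 100 := by
    rw [abs_of_nonneg (sq_nonneg _)]
    rcases eq_or_ne m 0 with rfl | hm
    · exact hsq0
    · linarith [hsqne m hm]
  have hf3 (m : ℤ) : |3 * ψ m ^ 2| ≤ 363 / 100 := by
    rw [abs_mul, abs_of_pos three_pos]
    linarith [hf1 m]
  have hw0 (w : lp (fun _ : ℤ => ℂ) 2) (hw : ⟪v, w⟫_ℂ = 0) : ‖w 0‖ ≤ 1 / 10 * ‖w‖ := by
    have h : w 0 = -⟪v - e, w⟫_ℂ := by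
      rw [inner_sub_left, hw, lp.inner_single_left]; simp
    rw [h, norm_neg]
    exact (norm_inner_le_norm _ _).trans (by gcongr)
  have hcos := Real.neg_one_le_cos p
  have hcos' := Real.cos_le_one p
  set M := discreteSchrodinger ε (Real.cos p) _ _ hf1 with hMdef
  set P := discreteSchrodinger ε (Real.cos p) _ _ hf3 with hPdef
  set D := multiplier _ _ hf1 with hDdef
  obtain ⟨k, hk⟩ : ∃ k : ℝ, k = 2 * ε * (1 - Real.cos p) := ⟨_, rfl⟩
  have hk0 : 0 ≤ k := by
    have : 0 ≤ 1 - Real.cos p := by linarith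
    rw [hk]; positivity
  have hk1 : k ≤ 1 / 2500 := by rw [hk]; nlinarith
  have hMv : M v = (-(k : ℂ)) • v := by
    ext m
    rw [hMdef, discreteSchrodinger_apply, lp.coeFn_smul, Pi.smul_apply, smul_eq_mul]
    simp only [hvm]
    have := congrArg (fun x : ℝ => (x : ℂ)) (heq m)
    push_cast at this
    rw [hk]; push_cast
    linear_combination -this
  have hPv : P v = (-(k : ℂ)) • v - (2 : ℂ) • D v := by
    rw [← hMv]
    ext m
    rw [lp.coeFn_sub, lp.coeFn_smul, Pi.sub_apply, Pi.smul_apply, hPdef, hMdef, hDdef,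
      discreteSchrodinger_apply, discreteSchrodinger_apply, multiplier_apply]
    push_cast [smul_eq_mul]
    ring
  have hPnorm : ‖P v‖ ≤ 3 := by
    calc ‖P v‖ ≤ ‖(-(k : ℂ)) • v‖ + ‖(2 : ℂ) • D v‖ := by rw [hPv]; exact norm_sub_le _ _
      _ = k * ‖v‖ + 2 * ‖D v‖ := by
        rw [norm_smul, norm_smul, norm_neg, Complex.norm_real, Real.norm_of_nonneg hk0]; simp
      _ ≤ 1 / 2500 * (11 / 10) + 2 * (121 / 100 * (11 / 10)) := by
        have := norm_multiplier_le hf1 v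
        gcongr
        linarith
      _ ≤ 3 := by norm_num
  have hPneg : (⟪v, P v⟫_ℂ).re ≤ 0 := by
    have hD : 0 ≤ (⟪v, D v⟫_ℂ).re := (hasSum_multiplier hf1 v).nonneg fun m => by positivity
    have hvv : (⟪v, v⟫_ℂ).re = ‖v‖ ^ 2 := inner_self_eq_norm_sq (𝕜 := ℂ) v
    have h2 : (2 : ℂ) = ((2 : ℝ) : ℂ) := by norm_num
    rw [hPv, inner_sub_right, inner_smul_right, inner_smul_right, h2, ← Complex.ofReal_neg,
      Complex.sub_re, Complex.re_ofReal_mul, Complex.re_ofReal_mul, hvv]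
    have : 0 ≤ k * ‖v‖ ^ 2 := by positivity
    linarith
  have hMpos (w : lp (fun _ : ℤ => ℂ) 2) (hw : ⟪v, w⟫_ℂ = 0) :
      ‖w‖ ^ 2 / 2 ≤ (⟪w, M w⟫_ℂ).re := by
    have h1 := le_inner_discreteSchrodinger hf1 ε _ hε.le hcos w
    have h2 := inner_multiplier_le hf1 (1 / 100) (6 / 5) (1 / 10) (by norm_num) (by linarith)
      hsqne w (hw0 w hw)
    nlinarith [sq_nonneg ‖w‖]
  have hPpos (w : lp (fun _ : ℤ => ℂ) 2) (hw : ⟪v, w⟫_ℂ = 0) :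
      ‖w‖ ^ 2 / 2 ≤ (⟪w, P w⟫_ℂ).re := by
    have h1 := le_inner_discreteSchrodinger hf3 ε _ hε.le hcos w
    have h2 := inner_multiplier_le hf3 (3 / 100) (18 / 5) (1 / 10) (by norm_num) (by linarith)
      (fun m hm => by linarith [hsqne m hm]) w (hw0 w hw)
    nlinarith [sq_nonneg ‖w‖]
  have key := eq_zero_of_common_negative_direction P M
    (discreteSchrodinger_isSymmetric hf3 ε _) (discreteSchrodinger_isSymmetric hf1 ε _)
    v k hk0 hk1 hv0 hv1 hMv hPnorm hPneg hMpos hPpos lam hlam ⟨U, hU⟩ ⟨W, hW⟩ ?_ ?_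
  · exact ⟨congrArg Subtype.val key.1, congrArg Subtype.val key.2⟩
  · ext m
    rw [hPdef, discreteSchrodinger_apply]
    have h := hLU m
    push_cast at h ⊢
    exact h
  · ext m
    rw [hMdef, discreteSchrodinger_apply]
    have h := hLW m
    push_cast at h ⊢
    exact h
end

section
/- (Theorem 2, asymptotic expansion of the imaginary eigenvalue.) Let e₀ ∈ l²(ℤ, ℝ) be the Kronecker delta sequence at site 0. There exist ε₀ > 0 and C > 0 such that for every ε ∈ (0, ε₀), every p ∈ [−π, π], and every solution ψ ∈ l²(ℤ, ℝ) of the stationary 1D dNLS equation with μ = 1 satisfying ψ_m > 0 for all m and ‖ψ − e₀‖_{l²} ≤ 2ε, there exist ω ∈ ℝ and a nonzero pair (U, W) ∈ l²(ℤ, ℂ)² with L₊(p)U = −iωW, L₋(p)W = iωU (X-point operators with μ = 1), such that |ω² − 8ε sin²(p/2)| ≤ Cε²; i.e., the stable line soliton possesses a pair of purely imaginary discrete eigenvalues ±iω(ε,p) with ω²(ε,p) = 8ε sin²(p/2) + O(ε²) as ε → 0. -/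
section NearProjection

variable {E : Type*} [NormedAddCommGroup E] [InnerProductSpace ℝ E]

/-- A small perturbation `B` of the orthogonal projection onto `eᗮ` has an eigenvector `e + x`
close to the unit vector `e`. -/
theorem exists_eigenvector_near_of_norm_le [CompleteSpace E] {e : E} (he : ‖e‖ = 1)
    (B : E →L[ℝ] E) {b : ℝ} (hB : ‖B‖ ≤ b) (hb : b ≤ 1 / 12) :
    ∃ (x : E) (β : ℝ), ‖x‖ ≤ 6 * b ∧ inner ℝ e x = 0 ∧ x + B (e + x) = β • (e + x) := by
  have hb0 : 0 ≤ b := (norm_nonneg B).trans hB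
  set f : E → ℝ := fun x => inner ℝ e (B (e + x)) with hf
  set T : E → E := fun x => f x • (e + x) - B (e + x) with hT
  have hBle : ∀ y, ‖B y‖ ≤ b * ‖y‖ := fun y =>
    (B.le_opNorm y).trans (mul_le_mul_of_nonneg_right hB (norm_nonneg y))
  have hin : ∀ y, |inner ℝ e y| ≤ ‖y‖ := fun y => by
    simpa [he] using abs_real_inner_le_norm e y
  set s : Set E := Metric.closedBall (0 : E) (6 * b) with hs
  have hmem : ∀ x ∈ s, ‖e + x‖ ≤ 2 := fun x hx => by
    have h1 : ‖x‖ ≤ 6 * b := by simpa [hs] using hx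
    have h2 := norm_add_le e x
    linarith
  have hBx : ∀ x ∈ s, ‖B (e + x)‖ ≤ 2 * b := fun x hx => by
    have := hBle (e + x)
    nlinarith [hmem x hx]
  have hfx : ∀ x ∈ s, |f x| ≤ 2 * b := fun x hx => (hin _).trans (hBx x hx)
  have hmaps : Set.MapsTo T s s := fun x hx => by
    have h1 : ‖T x‖ ≤ |f x| * ‖e + x‖ + ‖B (e + x)‖ := by
      rw [← Real.norm_eq_abs, ← norm_smul]
      exact norm_sub_le (f x • (e + x)) (B (e + x))
    have h2 : |f x| * ‖e + x‖ ≤ 2 * b * 2 :=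
      mul_le_mul (hfx x hx) (hmem x hx) (norm_nonneg _) (by positivity)
    have : ‖T x‖ ≤ 6 * b := by linarith [hBx x hx]
    simpa [hs] using this
  have hlip : ∀ x ∈ s, ∀ y ∈ s, ‖T x - T y‖ ≤ 1 / 2 * ‖x - y‖ := fun x hx y hy => by
    have hBd : B (e + x) - B (e + y) = B (x - y) := by
      rw [← map_sub]; congr 1; abel
    have hd : f x - f y = inner ℝ e (B (x - y)) := by
      rw [← hBd, inner_sub_right]
    have hdle : |f x - f y| ≤ b * ‖x - y‖ := by
      rw [hd]; exact (hin _).trans (hBle _)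
    have heq : T x - T y = (f x - f y) • (e + x) + f y • (x - y) - B (x - y) := by
      rw [← hBd]; simp only [hT]; module
    have h1 : ‖T x - T y‖ ≤ |f x - f y| * ‖e + x‖ + |f y| * ‖x - y‖ + ‖B (x - y)‖ := by
      rw [heq]
      refine (norm_sub_le _ _).trans ?_
      gcongr
      rw [← Real.norm_eq_abs, ← Real.norm_eq_abs, ← norm_smul, ← norm_smul]
      exact norm_add_le _ _
    have h2 : |f x - f y| * ‖e + x‖ ≤ b * ‖x - y‖ * 2 :=
      mul_le_mul hdle (hmem x hx) (norm_nonneg _) (by positivity)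
    have h3 : |f y| * ‖x - y‖ ≤ 2 * b * ‖x - y‖ :=
      mul_le_mul_of_nonneg_right (hfx y hy) (norm_nonneg _)
    have h4 := hBle (x - y)
    nlinarith [norm_nonneg (x - y)]
  have hK : ContractingWith (1 / 2) (hmaps.restrict T s s) := by
    refine ⟨by norm_num, LipschitzWith.of_dist_le_mul ?_⟩
    rintro ⟨x, hx⟩ ⟨y, hy⟩
    simpa [Subtype.dist_eq, dist_eq_norm] using hlip x hx y hy
  obtain ⟨x, hxs, hfix, -, -⟩ := ContractingWith.exists_fixedPoint'
    (Metric.isClosed_closedBall.isComplete : IsComplete s) hmaps hK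
    (x := 0) (by simp [hb0]) (edist_ne_top _ _)
  have hfix : f x • (e + x) - B (e + x) = x := hfix
  refine ⟨x, f x, by simpa [hs] using hxs, ?_, ?_⟩
  · have h1 : inner ℝ e x = f x * (1 + inner ℝ e x) - f x := by
      conv_lhs => rw [← hfix]
      rw [inner_sub_right, inner_smul_right, inner_add_right, real_inner_self_eq_norm_sq, he]
      simp [hf]
    have h2 := abs_le.mp (hfx x hxs)
    have h3 : (1 - f x) * inner ℝ e x = 0 := by linarith
    rcases mul_eq_zero.mp h3 with h | h
    · linarith
    · exact h
  · nth_rewrite 1 [← hfix]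
    abel

/-- Abstract form of the expansion: `L₋ = 1 - ⟨e, ·⟩e + N` and `L₊ = 1 - 3⟨e, ·⟩e + N'` with `N`,
`N'` of order `ε`, where `ψ` is close to `e` and is a (left) eigenvector of `L₋` for `-δ`. -/
theorem exists_eigenpair_of_norm_le [CompleteSpace E] {e ψ : E} (he : ‖e‖ = 1)
    (N N' : E →L[ℝ] E) {ε δ : ℝ} (hε : 0 < ε) (hε' : ε ≤ 1 / 10000)
    (hN : ‖N‖ ≤ 9 * ε) (hN' : ‖N'‖ ≤ 19 * ε) (hψ : ‖ψ - e‖ ≤ 2 * ε) (hδ : 0 ≤ δ) (hδ' : δ ≤ 4 * ε)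
    (hsymm : ∀ w : E, inner ℝ ψ (w - inner ℝ e w • e + N w) = -δ * inner ℝ ψ w) :
    ∃ (v w : E) (l : ℝ), 0 ≤ l ∧ w ≠ 0 ∧ v - (3 * inner ℝ e v) • e + N' v = w ∧
      w - inner ℝ e w • e + N w = l • v ∧ |l - 2 * δ| ≤ 24000 * ε ^ 2 := by
  set D : E →L[ℝ] E := (innerSL ℝ e).smulRight e with hD
  have hDx : ∀ x, D x = inner ℝ e x • e := fun x => rfl
  have hDn : ‖D‖ ≤ 1 := by
    rw [hD, ContinuousLinearMap.norm_smulRight_apply, innerSL_apply_norm, he]; norm_num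
  set Q : E →L[ℝ] E := ContinuousLinearMap.id ℝ E - D with hQ
  set R : E →L[ℝ] E := ContinuousLinearMap.id ℝ E - (3 : ℝ) • D with hR
  have hid := ContinuousLinearMap.norm_id_le (𝕜 := ℝ) (E := E)
  have hQn : ‖Q‖ ≤ 2 := (norm_sub_le _ _).trans (by linarith)
  have hRn : ‖R‖ ≤ 4 := (norm_sub_le _ _).trans (by
    rw [norm_smul]; norm_num; linarith)
  set B : E →L[ℝ] E := Q.comp N' + N.comp R + N.comp N' with hBdef
  have hB : ‖B‖ ≤ 80 * ε := by
    have h1 : ‖Q.comp N'‖ ≤ 2 * (19 * ε) := (Q.opNorm_comp_le N').trans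
      (mul_le_mul hQn hN' (norm_nonneg _) (by norm_num))
    have h2 : ‖N.comp R‖ ≤ 9 * ε * 4 := (N.opNorm_comp_le R).trans
      (mul_le_mul hN hRn (norm_nonneg _) (by positivity))
    have h3 : ‖N.comp N'‖ ≤ 9 * ε * (19 * ε) := (N.opNorm_comp_le N').trans
      (mul_le_mul hN hN' (norm_nonneg _) (by positivity))
    have h4 := norm_add₃_le (a := Q.comp N') (b := N.comp R) (c := N.comp N')
    have : ‖B‖ ≤ _ := h4
    nlinarith
  obtain ⟨x, β, hx, hex, hβ⟩ := exists_eigenvector_near_of_norm_le he B hB (by linarith)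
  have hee : inner ℝ e e = (1 : ℝ) := by rw [real_inner_self_eq_norm_sq, he]; norm_num
  set v := e + x with hv
  set w := v - (3 * inner ℝ e v) • e + N' v with hw
  have hev : inner ℝ e v = (1 : ℝ) := by rw [hv, inner_add_right, hee, hex, add_zero]
  have hvn : ‖v‖ ≤ 2 := (norm_add_le _ _).trans (by linarith)
  have hwe : w + (2 : ℝ) • e = x + N' v := by
    rw [hw, hev, hv]; module
  have hwn : ‖w + (2 : ℝ) • e‖ ≤ 518 * ε := by
    rw [hwe]
    have h1 : ‖N' v‖ ≤ 19 * ε * 2 := (N'.le_opNorm v).trans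
      (mul_le_mul hN' hvn (norm_nonneg _) (by positivity))
    have h2 := norm_add_le x (N' v)
    linarith
  have heig : w - inner ℝ e w • e + N w = β • v := by
    rw [← hβ]
    have hRv : R v = v - (3 * inner ℝ e v) • e := by
      simp [hR, hDx, smul_smul]
    have hQw : w - inner ℝ e w • e = Q w := by simp [hQ, hDx]
    have hwR : w = R v + N' v := by rw [hRv]
    have hQR : Q (R v) = x := by
      simp only [hQ, hRv, hev, hDx, sub_apply, ContinuousLinearMap.id_apply,
        inner_sub_right, inner_smul_right, hee]
      rw [hv]; module
    rw [hQw, hwR, map_add Q (R v), map_add N (R v), hQR]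
    simp only [hBdef, add_apply, ContinuousLinearMap.comp_apply]
    abel
  have hcs : ∀ y z : E, |inner ℝ y z| ≤ ‖y‖ * ‖z‖ := abs_real_inner_le_norm
  have ha : |inner ℝ ψ v - 1| ≤ 4 * ε := by
    have : inner ℝ ψ v - 1 = inner ℝ (ψ - e) v := by rw [inner_sub_left, hev]
    rw [this]
    refine (hcs _ _).trans ?_
    calc _ ≤ 2 * ε * 2 := mul_le_mul hψ hvn (norm_nonneg _) (by positivity)
      _ = _ := by ring
  have hc : |inner ℝ ψ w + 2| ≤ 600 * ε := by
    have h0 : inner ℝ ψ w + 2 = inner ℝ e (w + (2 : ℝ) • e) + inner ℝ (ψ - e) w := by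
      rw [inner_add_right e w, inner_smul_right, hee, inner_sub_left]; ring
    have hwn' : ‖w‖ ≤ 3 := by
      have h := norm_sub_le (w + (2 : ℝ) • e) ((2 : ℝ) • e)
      rw [add_sub_cancel_right, norm_smul, he] at h
      norm_num at h
      linarith
    have h1 := hcs e (w + (2 : ℝ) • e)
    have h2 : |inner ℝ (ψ - e) w| ≤ 2 * ε * 3 := (hcs _ _).trans
      (mul_le_mul hψ hwn' (norm_nonneg _) (by positivity))
    rw [he, one_mul] at h1
    rw [h0]
    refine (abs_add_le _ _).trans ?_
    linarith
  have hkey : β * inner ℝ ψ v = -δ * inner ℝ ψ w := by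
    rw [← hsymm w, heig, inner_smul_right]
  rw [abs_le] at ha hc
  set a : ℝ := inner ℝ ψ v
  set c : ℝ := inner ℝ ψ w with hcdef
  have ha2 : 1 / 2 ≤ a := by linarith
  have hc2 : c ≤ -1 := by linarith
  refine ⟨v, w, β, ?_, ?_, rfl, heig, ?_⟩
  · by_contra! h
    nlinarith
  · intro h
    rw [hcdef, h, inner_zero_right] at hc2
    linarith
  · have h1 : (β - 2 * δ) * a = -δ * (c + 2 * a) := by linarith
    have h2 : |c + 2 * a| ≤ 608 * ε := abs_le.mpr ⟨by linarith, by linarith⟩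
    have h3 : |β - 2 * δ| * a = δ * |c + 2 * a| := by
      rw [← abs_of_pos (by linarith : 0 < a), ← abs_mul, abs_of_pos (by linarith : 0 < a), h1,
        abs_mul, abs_neg, abs_of_nonneg hδ]
    have h4 : δ * |c + 2 * a| ≤ 4 * ε * (608 * ε) :=
      mul_le_mul hδ' h2 (abs_nonneg _) (by positivity)
    nlinarith [abs_nonneg (β - 2 * δ)]

end NearProjection

section SequenceOperators

theorem memℓp_two_iff_summable_sq {ι : Type*} {f : ι → ℝ} :
    Memℓp f 2 ↔ Summable fun i => f i ^ 2 := by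
  rw [memℓp_gen_iff (by norm_num)]
  simp

theorem lp_two_norm_sq {ι : Type*} (f : lp (fun _ : ι => ℝ) 2) : ‖f‖ ^ 2 = ∑' i, f i ^ 2 := by
  simpa using lp.norm_rpow_eq_tsum (p := 2) (by norm_num) f

theorem lp_two_summable_sq {ι : Type*} (f : lp (fun _ : ι => ℝ) 2) :
    Summable fun i => f i ^ 2 :=
  memℓp_two_iff_summable_sq.mp (lp.memℓp f)

/-- Reindexing of square-summable sequences along a permutation of the index set. -/
noncomputable def lpReindex {ι : Type*} (σ : ι ≃ ι) :
    lp (fun _ : ι => ℝ) 2 →L[ℝ] lp (fun _ : ι => ℝ) 2 :=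
  LinearMap.mkContinuous
    { toFun := fun f => ⟨fun i => f (σ i), memℓp_two_iff_summable_sq.mpr
        (σ.summable_iff.mpr (lp_two_summable_sq f))⟩
      map_add' := fun _ _ => rfl
      map_smul' := fun _ _ => rfl } 1 (fun f => by
        refine le_of_eq ?_
        rw [one_mul, ← sq_eq_sq₀ (norm_nonneg _) (norm_nonneg _), lp_two_norm_sq, lp_two_norm_sq]
        exact σ.tsum_eq (fun i => f i ^ 2))

theorem lpReindex_apply {ι : Type*} (σ : ι ≃ ι) (f : lp (fun _ : ι => ℝ) 2) (i : ι) :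
    lpReindex σ f i = f (σ i) := rfl

theorem norm_lpReindex_le {ι : Type*} (σ : ι ≃ ι) : ‖lpReindex σ‖ ≤ 1 :=
  LinearMap.mkContinuous_norm_le _ zero_le_one _

theorem inner_lpReindex {ι : Type*} (σ : ι ≃ ι) (f g : lp (fun _ : ι => ℝ) 2) :
    inner ℝ f (lpReindex σ g) = inner ℝ (lpReindex σ.symm f) g := by
  rw [lp.inner_eq_tsum, lp.inner_eq_tsum,
    ← σ.tsum_eq (fun i => inner ℝ (lpReindex σ.symm f i) (g i))]
  simp [lpReindex_apply]

theorem sq_mul_le_of_abs_le {c b : ℝ} (hc : |c| ≤ b) (x : ℝ) : (c * x) ^ 2 ≤ b ^ 2 * x ^ 2 := by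
  rw [mul_pow, ← sq_abs c]
  exact mul_le_mul_of_nonneg_right (pow_le_pow_left₀ (abs_nonneg _) hc 2) (sq_nonneg _)

theorem summable_sq_mul_of_abs_le {ι : Type*} {c : ι → ℝ} {b : ℝ} (hc : ∀ i, |c i| ≤ b)
    (f : lp (fun _ : ι => ℝ) 2) : Summable fun i => (c i * f i) ^ 2 :=
  Summable.of_nonneg_of_le (fun _ => sq_nonneg _) (fun i => sq_mul_le_of_abs_le (hc i) (f i))
    ((lp_two_summable_sq f).mul_left _)

/-- Multiplication of square-summable sequences by a sequence bounded by `b`. -/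
noncomputable def lpMul {ι : Type*} (c : ι → ℝ) (b : ℝ) (hc : ∀ i, |c i| ≤ b) :
    lp (fun _ : ι => ℝ) 2 →L[ℝ] lp (fun _ : ι => ℝ) 2 :=
  LinearMap.mkContinuous
    { toFun := fun f => ⟨fun i => c i * f i,
        memℓp_two_iff_summable_sq.mpr (summable_sq_mul_of_abs_le hc f)⟩
      map_add' := fun f g => by ext i; exact mul_add _ _ _
      map_smul' := fun r f => by ext i; exact mul_left_comm _ _ _ } |b| (fun f => by
        refine (sq_le_sq₀ (norm_nonneg _) (by positivity)).mp ?_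
        rw [mul_pow, sq_abs, lp_two_norm_sq, lp_two_norm_sq, ← tsum_mul_left]
        exact (summable_sq_mul_of_abs_le hc f).tsum_le_tsum
          (fun i => sq_mul_le_of_abs_le (hc i) (f i)) ((lp_two_summable_sq f).mul_left _))

theorem lpMul_apply {ι : Type*} (c : ι → ℝ) (b : ℝ) (hc : ∀ i, |c i| ≤ b)
    (f : lp (fun _ : ι => ℝ) 2) (i : ι) : lpMul c b hc f i = c i * f i := rfl

theorem norm_lpMul_le {ι : Type*} (c : ι → ℝ) (b : ℝ) (hc : ∀ i, |c i| ≤ b) :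
    ‖lpMul c b hc‖ ≤ |b| :=
  LinearMap.mkContinuous_norm_le _ (abs_nonneg b) _

theorem inner_lpMul {ι : Type*} (c : ι → ℝ) (b : ℝ) (hc : ∀ i, |c i| ≤ b)
    (f g : lp (fun _ : ι => ℝ) 2) :
    inner ℝ f (lpMul c b hc g) = inner ℝ (lpMul c b hc f) g := by
  rw [lp.inner_eq_tsum, lp.inner_eq_tsum]
  refine tsum_congr fun i => ?_
  simp only [lpMul_apply, RCLike.inner_apply, conj_trivial]
  ring

/-- The bounded operator `w ↦ -ε (w_{m+1} + w_{m-1}) + r w_m - k c_m w_m`. -/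
noncomputable def latticePerturbation (ε r k : ℝ) (c : ℤ → ℝ) (b : ℝ) (hc : ∀ i, |c i| ≤ b) :
    lp (fun _ : ℤ => ℝ) 2 →L[ℝ] lp (fun _ : ℤ => ℝ) 2 :=
  -ε • (lpReindex (Equiv.addRight 1) + lpReindex (Equiv.addRight 1).symm)
    + r • ContinuousLinearMap.id ℝ _ - k • lpMul c b hc

theorem latticePerturbation_apply (ε r k : ℝ) (c : ℤ → ℝ) (b : ℝ) (hc : ∀ i, |c i| ≤ b)
    (f : lp (fun _ : ℤ => ℝ) 2) (m : ℤ) :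
    latticePerturbation ε r k c b hc f m =
      -ε * (f (m + 1) + f (m - 1)) + r * f m - k * (c m * f m) := by
  simp only [latticePerturbation, sub_apply, add_apply, smul_apply, ContinuousLinearMap.id_apply,
    lp.coeFn_add, lp.coeFn_sub, lp.coeFn_smul, Pi.add_apply, Pi.sub_apply, Pi.smul_apply,
    smul_eq_mul, lpReindex_apply, lpMul_apply, Equiv.addRight_symm, Equiv.coe_addRight]
  rw [← sub_eq_add_neg m 1]

theorem norm_latticePerturbation_le (ε r k : ℝ) (c : ℤ → ℝ) (b : ℝ) (hc : ∀ i, |c i| ≤ b) :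
    ‖latticePerturbation ε r k c b hc‖ ≤ 2 * |ε| + |r| + |k| * |b| := by
  refine (norm_sub_le _ _).trans ?_
  rw [norm_smul k]
  refine add_le_add ((norm_add_le _ _).trans (add_le_add ?_ ?_))
    (mul_le_mul_of_nonneg_left (norm_lpMul_le c b hc) (norm_nonneg _))
  · rw [norm_smul, norm_neg, Real.norm_eq_abs, mul_comm]
    refine mul_le_mul_of_nonneg_right ((norm_add_le _ _).trans ?_) (abs_nonneg _)
    linarith [norm_lpReindex_le (Equiv.addRight (1 : ℤ)),
      norm_lpReindex_le (Equiv.addRight (1 : ℤ)).symm]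
  · rw [norm_smul]
    exact mul_le_of_le_one_right (norm_nonneg _) ContinuousLinearMap.norm_id_le

theorem inner_latticePerturbation (ε r k : ℝ) (c : ℤ → ℝ) (b : ℝ) (hc : ∀ i, |c i| ≤ b)
    (f g : lp (fun _ : ℤ => ℝ) 2) :
    inner ℝ f (latticePerturbation ε r k c b hc g) =
      inner ℝ (latticePerturbation ε r k c b hc f) g := by
  simp only [latticePerturbation, sub_apply, add_apply,
    smul_apply, ContinuousLinearMap.id_apply, inner_sub_left, inner_sub_right,
    inner_add_left, inner_add_right, inner_smul_right, real_inner_smul_left, inner_lpReindex,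
    inner_lpMul, Equiv.symm_symm]
  ring

end SequenceOperators


/-- Theorem 2 (asymptotic expansion of the purely imaginary eigenvalue at the X
point). Near the anti-continuum limit, for the fundamental line soliton `ψ ≈ e₀`
(with `μ = 1`), the X-point linear-stability problem has a pair of purely imaginary
eigenvalues `±iω` with `ω² = 8ε sin²(p/2) + O(ε²)`, uniformly in `p ∈ [-π,π]`. -/
theorem imaginary_eigenvalue_expansion_X :
    ∃ ε₀ C : ℝ, 0 < ε₀ ∧ 0 < C ∧
      ∀ ε : ℝ, 0 < ε → ε < ε₀ →
      ∀ p : ℝ, p ∈ Set.Icc (-Real.pi) Real.pi →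
      ∀ ψ : ℤ → ℝ, Memℓp ψ 2 → (∀ m : ℤ, 0 < ψ m) →
      (∀ m : ℤ, -ψ m + ε * (ψ (m + 1) + ψ (m - 1) - 2 * ψ m) + (ψ m) ^ 3 = 0) →
      Real.sqrt (∑' m : ℤ, (ψ m - if m = 0 then 1 else 0) ^ 2) ≤ 2 * ε →
      ∃ (ω : ℝ) (U W : ℤ → ℂ), Memℓp U 2 ∧ Memℓp W 2 ∧ ¬(U = 0 ∧ W = 0) ∧
        (∀ m : ℤ, -(ε : ℂ) * (U (m + 1) + U (m - 1) - 2 * (Real.cos p : ℂ) * U m)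
          + U m - 3 * ((ψ m : ℝ) : ℂ) ^ 2 * U m = (-(Complex.I * (ω : ℂ))) * W m) ∧
        (∀ m : ℤ, -(ε : ℂ) * (W (m + 1) + W (m - 1) - 2 * (Real.cos p : ℂ) * W m)
          + W m - ((ψ m : ℝ) : ℂ) ^ 2 * W m = (Complex.I * (ω : ℂ)) * U m) ∧
        |ω ^ 2 - 8 * ε * Real.sin (p / 2) ^ 2| ≤ C * ε ^ 2 := by
  refine ⟨1 / 10000, 24000, by norm_num, by norm_num, ?_⟩
  intro ε hε hε' p _ ψ hψ _ hstat hdist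
  set e : lp (fun _ : ℤ => ℝ) 2 := lp.single 2 0 (1 : ℝ) with he
  have hem : ∀ m, e m = if m = 0 then 1 else 0 := fun m => by
    simp [he, lp.single_apply, Pi.single_apply]
  have hen : ‖e‖ = 1 := by rw [he, lp.norm_single (by norm_num)]; simp
  set Ψ : lp (fun _ : ℤ => ℝ) 2 := ⟨ψ, hψ⟩ with hΨ
  have hΨm : ∀ m, Ψ m = ψ m := fun m => rfl
  have hin : ∀ w : lp (fun _ : ℤ => ℝ) 2, inner ℝ e w = w 0 := fun w => by
    rw [he, lp.inner_single_left]; simp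
  have hΨe : ‖Ψ - e‖ ≤ 2 * ε := by
    rw [← Real.sqrt_sq (norm_nonneg (Ψ - e)), lp_two_norm_sq]
    simpa [hem, hΨm] using hdist
  have hclose : ∀ m, |ψ m - e m| ≤ 2 * ε := fun m =>
    (lp.norm_apply_le_norm (by norm_num) (Ψ - e) m).trans hΨe
  have he01 : ∀ m, e m * e m = e m ∧ |e m| ≤ 1 := fun m => by
    rw [hem]; split_ifs <;> simp
  have hc : ∀ m, |ψ m ^ 2 - e m| ≤ 5 * ε := fun m => by
    obtain ⟨h1, h2⟩ := he01 m
    have h3 := hclose m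
    have h4 : ψ m ^ 2 - e m = (ψ m - e m) * ((ψ m - e m) + 2 * e m) := by linear_combination h1
    have h5 : |(ψ m - e m) + 2 * e m| ≤ 2 * ε + 2 := by
      refine (abs_add_le _ _).trans ?_
      rw [abs_mul, abs_two]; linarith
    rw [h4, abs_mul]
    have := mul_le_mul h3 h5 (abs_nonneg _) (by positivity)
    nlinarith
  have hr : |2 * ε * Real.cos p| ≤ 2 * ε := by
    rw [abs_mul, abs_of_pos (by positivity : 0 < 2 * ε)]
    exact mul_le_of_le_one_right (by positivity) (Real.abs_cos_le_one p)
  set N := latticePerturbation ε (2 * ε * Real.cos p) 1 (fun m => ψ m ^ 2 - e m) (5 * ε) hc with hN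
  set N' := latticePerturbation ε (2 * ε * Real.cos p) 3 (fun m => ψ m ^ 2 - e m) (5 * ε) hc with hN'
  have hNn : ‖N‖ ≤ 9 * ε := by
    refine (norm_latticePerturbation_le _ _ _ _ _ _).trans ?_
    rw [abs_of_pos hε, abs_of_pos (by positivity : 0 < 5 * ε), abs_one]
    linarith
  have hNn' : ‖N'‖ ≤ 19 * ε := by
    refine (norm_latticePerturbation_le _ _ _ _ _ _).trans ?_
    rw [abs_of_pos hε, abs_of_pos (by positivity : 0 < 5 * ε), abs_of_pos (by norm_num : (0:ℝ) < 3)]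
    linarith
  have hcos : Real.cos p = 1 - 2 * Real.sin (p / 2) ^ 2 := by
    have h := Real.cos_two_mul (p / 2)
    rw [mul_div_cancel₀ p two_ne_zero] at h
    linarith [Real.sin_sq_add_cos_sq (p / 2)]
  have he0 : ∀ (w : lp (fun _ : ℤ => ℝ) 2) (m : ℤ), w 0 * e m = w m * e m := fun w m => by
    rw [hem]; split_ifs with h <;> simp [h]
  set δ := 4 * ε * Real.sin (p / 2) ^ 2 with hδ
  have hsymm : ∀ w, inner ℝ Ψ (w - inner ℝ e w • e + N w) = -δ * inner ℝ Ψ w := fun w => by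
    have hΨeig : Ψ - inner ℝ e Ψ • e + N Ψ = -δ • Ψ := by
      ext m
      have h1 := hstat m
      have h2 := he0 Ψ m
      simp only [hin, lp.coeFn_add, lp.coeFn_sub, lp.coeFn_smul, Pi.add_apply, Pi.sub_apply,
        Pi.smul_apply, smul_eq_mul, hN, latticePerturbation_apply]
      simp only [hΨm] at h2 ⊢
      rw [h2, hcos, hδ]
      linear_combination -h1
    rw [← real_inner_smul_left, ← hΨeig]
    simp only [inner_sub_left, inner_sub_right, inner_add_left, inner_add_right, inner_smul_right,
      real_inner_smul_left, hN, inner_latticePerturbation]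
    rw [real_inner_comm e Ψ]
    ring
  have hsin : Real.sin (p / 2) ^ 2 ≤ 1 := Real.sin_sq_le_one _
  obtain ⟨v, w, l, hl, hw0, hvw, hwv, hbound⟩ := exists_eigenpair_of_norm_le hen N N' hε hε'.le
    hNn hNn' hΨe (δ := δ) (by positivity) (by nlinarith) hsymm
  have hs : Real.sqrt l ^ 2 = l := Real.sq_sqrt hl
  have hplus : ∀ m, -ε * (v (m + 1) + v (m - 1) - 2 * Real.cos p * v m) + v m
      - 3 * ψ m ^ 2 * v m = w m := fun m => by
    rw [← hvw]
    have h2 := he0 v m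
    simp only [hin, lp.coeFn_add, lp.coeFn_sub, lp.coeFn_smul, Pi.add_apply, Pi.sub_apply,
      Pi.smul_apply, smul_eq_mul, hN', latticePerturbation_apply]
    linear_combination 3 * h2
  have hminus : ∀ m, -ε * (w (m + 1) + w (m - 1) - 2 * Real.cos p * w m) + w m
      - ψ m ^ 2 * w m = l * v m := fun m => by
    have h1 := congrArg (fun f : lp (fun _ : ℤ => ℝ) 2 => f m) hwv
    have h2 := he0 w m
    simp only [hin, lp.coeFn_add, lp.coeFn_sub, lp.coeFn_smul, Pi.add_apply, Pi.sub_apply,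
      Pi.smul_apply, smul_eq_mul, hN, latticePerturbation_apply] at h1
    linear_combination h1 + h2
  have hmem : ∀ f : lp (fun _ : ℤ => ℝ) 2, Memℓp (fun m => (f m : ℂ)) 2 := fun f => by
    rw [memℓp_gen_iff (by norm_num)]
    simpa using lp_two_summable_sq f
  refine ⟨Real.sqrt l, fun m => (-(Complex.I * (Real.sqrt l : ℂ))) * v m, fun m => w m,
    (hmem v).const_mul _, hmem w, ?_, ?_, ?_, ?_⟩
  · rintro ⟨-, hW⟩
    refine hw0 ?_
    ext m
    simpa using congrFun hW m
  · intro m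
    have h := congrArg (fun t : ℝ => (t : ℂ)) (hplus m)
    push_cast at h
    push_cast
    linear_combination (-(Complex.I * (Real.sqrt l : ℂ))) * h
  · intro m
    have h := congrArg (fun t : ℝ => (t : ℂ)) (hminus m)
    have hs' : (Real.sqrt l : ℂ) ^ 2 = l := by rw [← Complex.ofReal_pow, hs]
    push_cast at h
    push_cast
    rw [h, ← hs']
    linear_combination (Real.sqrt l : ℂ) ^ 2 * v m * Complex.I_sq
  · rw [hs]
    have : 8 * ε * Real.sin (p / 2) ^ 2 = 2 * δ := by rw [hδ]; ring
    rwa [this]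
end
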